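/- For every integer n ≥ 4 there exists an explicitly computable c_n ∈ (0,1) — one may take c_n = ((n−3)/(8(n−2)^{3/2}))·√π·Γ(n−1/2)/Γ(n), where Γ is the Euler Gamma function — such that for every c ∈ [0, c_n), the set FS_n(c) = DI_n(c) \ Bad_n has Hausdorff dimension at least n − 2. -/

import Mathlib

open Filter MeasureTheory
open scoped ENNReal

/-- `ψ_ξ(t)`: the minimum of `|b₁ξ₁+⋯+b_nξ_n+b_{n+1}|` over integer vectors
`(b₁,…,b_{n+1})` with `1 ≤ max_i |b_i| ≤ t` (dual approximation, maximum norm). -/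
noncomputable def psiDual (n : ℕ) (ξ : Fin n → ℝ) (t : ℝ) : ℝ :=
  sInf { r : ℝ | ∃ (b : Fin n → ℤ) (b' : ℤ),
    (∃ i, b i ≠ 0) ∧ (∀ i, |(b i : ℝ)| ≤ t) ∧
    r = |(∑ i, (b i : ℝ) * ξ i) + (b' : ℝ)| }

/-- `Θ(ξ) = limsup_{t→∞} tⁿ ψ_ξ(t)`. -/
noncomputable def ThetaDual (n : ℕ) (ξ : Fin n → ℝ) : ℝ :=
  limsup (fun t : ℝ => t ^ n * psiDual n ξ t) atTop

/-- `Θ̃(ξ) = liminf_{t→∞} tⁿ ψ_ξ(t)`. -/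
noncomputable def ThetaTildeDual (n : ℕ) (ξ : Fin n → ℝ) : ℝ :=
  liminf (fun t : ℝ => t ^ n * psiDual n ξ t) atTop

/-- `FS_n(c) = DI_n(c) \ Bad_n`. -/
def FSdualC (n : ℕ) (c : ℝ) : Set (Fin n → ℝ) :=
  {ξ | ThetaDual n ξ = c} \ {ξ | 0 < ThetaTildeDual n ξ}

section

open Matrix

/-- The entries of `M` lie in `[0, S)` off the diagonal and in `[R, R + S)` on the diagonal. -/
def NearDiag {m : ℕ} (R S : ℕ) (M : Matrix (Fin m) (Fin m) ℤ) : Prop :=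
  ∀ i j, (if i = j then (R : ℤ) else 0) ≤ M i j ∧ M i j < (if i = j then (R : ℤ) else 0) + S

lemma NearDiag.transpose {m R S : ℕ} {M : Matrix (Fin m) (Fin m) ℤ} (h : NearDiag R S M) :
    NearDiag R S Mᵀ := fun i j => by
  have := h j i
  simpa [Matrix.transpose_apply, eq_comm] using this

lemma NearDiag.sum_le {m R S : ℕ} {M : Matrix (Fin m) (Fin m) ℤ} (h : NearDiag R S M)
    (i : Fin m) : ∑ j, |(M i j : ℝ)| ≤ R + m * S := by
  have h1 : ∀ j, |(M i j : ℝ)| ≤ (if i = j then (R : ℝ) else 0) + S := by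
    intro j
    obtain ⟨h1, h2⟩ := h i j
    have h0 : (0 : ℤ) ≤ M i j := le_trans (by split_ifs <;> positivity) h1
    rw [abs_of_nonneg (by exact_mod_cast h0)]
    have : (M i j : ℝ) < (if i = j then (R : ℝ) else 0) + S := by
      split_ifs at h2 ⊢ <;> exact_mod_cast h2
    exact this.le
  calc ∑ j, |(M i j : ℝ)| ≤ ∑ j, ((if i = j then (R : ℝ) else 0) + S) :=
        Finset.sum_le_sum fun j _ => h1 j
    _ = R + m * S := by simp [Finset.sum_add_distrib]

/-- Diagonal dominance: a vector with small image is small. -/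
lemma NearDiag.dominance {m R S : ℕ} {M : Matrix (Fin m) (Fin m) ℤ} (h : NearDiag R S M)
    (hR : m * S ≤ R) (x : Fin m → ℝ) (r : ℝ) (hx : ∀ i, |∑ j, (M i j : ℝ) * x j| ≤ r)
    (i : Fin m) : ((R : ℝ) - m * S) * |x i| ≤ r := by
  obtain ⟨i₀, -, hi₀⟩ := Finset.exists_max_image Finset.univ (fun i => |x i|) ⟨i, Finset.mem_univ i⟩
  have hRS : (0 : ℝ) ≤ R - m * S := by
    have : ((m * S : ℕ) : ℝ) ≤ R := by exact_mod_cast hR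
    push_cast at this; linarith
  refine le_trans (mul_le_mul_of_nonneg_left (hi₀ i (Finset.mem_univ i)) hRS) ?_
  refine le_trans ?_ (hx i₀)
  have hE : ∀ j, |((M i₀ j : ℝ) - if i₀ = j then (R : ℝ) else 0)| ≤ S := by
    intro j
    obtain ⟨h1, h2⟩ := h i₀ j
    rw [abs_le]
    constructor
    · have : (if i₀ = j then (R : ℝ) else 0) ≤ M i₀ j := by
        split_ifs at h1 ⊢ <;> exact_mod_cast h1
      have : (0 : ℝ) ≤ S := Nat.cast_nonneg S
      linarith
    · have : (M i₀ j : ℝ) < (if i₀ = j then (R : ℝ) else 0) + S := by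
        split_ifs at h2 ⊢ <;> exact_mod_cast h2
      linarith
  have hsplit : ∑ j, (M i₀ j : ℝ) * x j =
      R * x i₀ + ∑ j, ((M i₀ j : ℝ) - if i₀ = j then (R : ℝ) else 0) * x j := by
    simp [sub_mul, Finset.sum_sub_distrib]
  have hb : |∑ j, ((M i₀ j : ℝ) - if i₀ = j then (R : ℝ) else 0) * x j| ≤ m * (S * |x i₀|) := by
    refine le_trans (Finset.abs_sum_le_sum_abs _ _) ?_
    calc _ ≤ ∑ _j : Fin m, (S : ℝ) * |x i₀| := Finset.sum_le_sum fun j _ => by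
          rw [abs_mul]
          exact mul_le_mul (hE j) (hi₀ j (Finset.mem_univ j)) (abs_nonneg _) (Nat.cast_nonneg _)
      _ = _ := by simp
  have hRx : |(R : ℝ) * x i₀| = R * |x i₀| := by rw [abs_mul, Nat.abs_cast]
  have := abs_sub_abs_le_abs_sub ((R : ℝ) * x i₀)
    (-∑ j, ((M i₀ j : ℝ) - if i₀ = j then (R : ℝ) else 0) * x j)
  rw [abs_neg, sub_neg_eq_add, ← hsplit] at this
  linarith

lemma NearDiag.vecMul_eq_zero {m R S : ℕ} {M : Matrix (Fin m) (Fin m) ℤ} (h : NearDiag R S M)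
    (hR : m * S ≤ R) (k : Fin m → ℤ) (hk : ∀ j, |(k ᵥ* M) j| + m * S < R) : k = 0 := by
  rcases Nat.eq_zero_or_pos m with rfl | hm
  · exact Subsingleton.elim _ _
  obtain ⟨j₀, -, hj₀⟩ := Finset.exists_max_image Finset.univ (fun j => |(k ᵥ* M) j|)
    ⟨⟨0, hm⟩, Finset.mem_univ _⟩
  have hlt : (|(k ᵥ* M) j₀| : ℝ) < (R : ℝ) - m * S := by
    have : ((|(k ᵥ* M) j₀| + m * S : ℤ) : ℝ) < (R : ℤ) := by exact_mod_cast hk j₀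
    push_cast at this; linarith
  funext i
  have := h.transpose.dominance hR (fun i => (k i : ℝ)) (|(k ᵥ* M) j₀| : ℝ) (fun j => by
    have hj := hj₀ j (Finset.mem_univ j)
    have e : ∑ i, ((Mᵀ j i : ℤ) : ℝ) * (k i : ℝ) = ((k ᵥ* M) j : ℤ) := by
      simp [Matrix.vecMul, dotProduct, mul_comm]
    rw [e]
    exact_mod_cast hj) i
  by_contra hne
  have h1 : (1 : ℝ) ≤ |(k i : ℝ)| := by exact_mod_cast Int.one_le_abs hne
  have hpos : (0 : ℝ) < (R : ℝ) - m * S := lt_of_le_of_lt (abs_nonneg _) hlt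
  nlinarith

lemma NearDiag.det_ne_zero {m R S : ℕ} {M : Matrix (Fin m) (Fin m) ℤ} (h : NearDiag R S M)
    (hR : m * S < R) : M.det ≠ 0 := by
  intro h0
  obtain ⟨v, hv, hv0⟩ := Matrix.exists_vecMul_eq_zero_iff.2 h0
  exact hv (h.vecMul_eq_zero hR.le v (fun j => by rw [hv0]; simp; exact_mod_cast hR))

lemma abs_det_le_prod_sum_abs {m : ℕ} (A : Matrix (Fin m) (Fin m) ℝ) :
    |A.det| ≤ ∏ i, ∑ j, |A i j| := by
  rw [Finset.prod_univ_sum, ← Matrix.det_transpose, Matrix.det_apply]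
  refine le_trans (Finset.abs_sum_le_sum_abs _ _) ?_
  have : ∀ σ : Equiv.Perm (Fin m), |Equiv.Perm.sign σ • ∏ i, Aᵀ (σ i) i| = ∏ i, |A i (σ i)| := by
    intro σ
    rcases Int.units_eq_one_or (Equiv.Perm.sign σ) with h | h <;>
      simp [h, Finset.abs_prod]
  simp_rw [this]
  rw [← Finset.sum_image (s := Finset.univ) (g := fun σ : Equiv.Perm (Fin m) => (σ : Fin m → Fin m))
    (f := fun x => ∏ i, |A i (x i)|)]
  · refine Finset.sum_le_sum_of_subset_of_nonneg ?_ fun x _ _ => Finset.prod_nonneg fun i _ => abs_nonneg _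
    intro x _
    simp
  · intro a _ b _ hab
    exact DFunLike.coe_injective hab

lemma NearDiag.abs_det_le {m R S : ℕ} {M : Matrix (Fin m) (Fin m) ℤ} (h : NearDiag R S M) :
    |(M.det : ℝ)| ≤ ((R : ℝ) + m * S) ^ m := by
  have h1 := abs_det_le_prod_sum_abs (M.map (Int.castRingHom ℝ))
  rw [← RingHom.mapMatrix_apply, ← RingHom.map_det] at h1
  refine le_trans h1 ?_
  calc _ ≤ ∏ _i : Fin m, ((R : ℝ) + m * S) :=
        Finset.prod_le_prod (fun i _ => Finset.sum_nonneg fun j _ => abs_nonneg _)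
          (fun i _ => by simpa using h.sum_le i)
    _ = _ := by simp

/-- Integer vectors whose scalar product with `η` is an integer are integer combinations of
the rows of `M`. -/
def GoodCentre {m : ℕ} (M : Matrix (Fin m) (Fin m) ℤ) (η : Fin m → ℝ) : Prop :=
  ∀ b : Fin m → ℤ, (∃ z : ℤ, ∑ i, (b i : ℝ) * η i = z) → ∃ k : Fin m → ℤ, b = k ᵥ* M

lemma det_mul_eq_int {m : ℕ} {M : Matrix (Fin m) (Fin m) ℤ} {η : Fin m → ℝ} {c : Fin m → ℤ}
    (hη : ∀ i, ∑ j, (M i j : ℝ) * η j = c i) (i : Fin m) :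
    (M.det : ℝ) * η i = (M.adjugate *ᵥ c) i := by
  have hη' : (M.map (Int.castRingHom ℝ)) *ᵥ η = fun i => ((c i : ℤ) : ℝ) := by
    funext i
    simpa [Matrix.mulVec, dotProduct] using hη i
  have h2 : (M.map (Int.castRingHom ℝ)).adjugate *ᵥ ((M.map (Int.castRingHom ℝ)) *ᵥ η) =
      (M.det : ℝ) • η := by
    rw [Matrix.mulVec_mulVec, Matrix.adjugate_mul, ← RingHom.mapMatrix_apply, ← RingHom.map_det,
      Matrix.smul_mulVec, Matrix.one_mulVec]
    rfl
  rw [hη', ← RingHom.mapMatrix_apply, ← RingHom.map_adjugate] at h2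
  have := congrFun h2 i
  simp only [Pi.smul_apply, smul_eq_mul] at this
  rw [← this]
  simp [Matrix.mulVec, dotProduct]

lemma det_mul_dot_eq_int {m : ℕ} {M : Matrix (Fin m) (Fin m) ℤ} {η : Fin m → ℝ} {c : Fin m → ℤ}
    (hη : ∀ i, ∑ j, (M i j : ℝ) * η j = c i) (b : Fin m → ℤ) :
    (M.det : ℝ) * ∑ i, (b i : ℝ) * η i = ((∑ i, b i * (M.adjugate *ᵥ c) i : ℤ) : ℝ) := by
  simp only [Int.cast_sum, Int.cast_mul]
  rw [Finset.mul_sum]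
  refine Finset.sum_congr rfl fun i _ => ?_
  rw [← det_mul_eq_int hη]; ring

/-- A value `∑ b i * η i + z` that is not zero is at least `1 / |det M|`. -/
lemma one_le_abs_det_mul {m : ℕ} {M : Matrix (Fin m) (Fin m) ℤ} {η : Fin m → ℝ} {c : Fin m → ℤ}
    (hη : ∀ i, ∑ j, (M i j : ℝ) * η j = c i) (b : Fin m → ℤ) (z : ℤ)
    (hne : ∑ i, (b i : ℝ) * η i + z ≠ 0) (hdet : M.det ≠ 0) :
    1 ≤ |(M.det : ℝ)| * |∑ i, (b i : ℝ) * η i + z| := by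
  rw [← abs_mul, mul_add, det_mul_dot_eq_int hη b]
  have : ((∑ i, b i * (M.adjugate *ᵥ c) i : ℤ) : ℝ) + (M.det : ℝ) * z =
      ((∑ i, b i * (M.adjugate *ᵥ c) i + M.det * z : ℤ) : ℝ) := by push_cast; ring
  rw [this]
  have hN : ∑ i, b i * (M.adjugate *ᵥ c) i + M.det * z ≠ 0 := by
    intro h0
    have h1 : (M.det : ℝ) * (∑ i, (b i : ℝ) * η i + z) = 0 := by
      rw [mul_add, det_mul_dot_eq_int hη b, this, h0]; simp
    rcases mul_eq_zero.1 h1 with h | h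
    · exact hdet (by exact_mod_cast h)
    · exact hne h
  exact_mod_cast Int.one_le_abs hN

lemma GoodCentre.one_le {m R S : ℕ} {M : Matrix (Fin m) (Fin m) ℤ} {η : Fin m → ℝ}
    {c : Fin m → ℤ} (hM : NearDiag R S M) (hη : ∀ i, ∑ j, (M i j : ℝ) * η j = c i)
    (hR : m * S < R) (hg : GoodCentre M η) (b : Fin m → ℤ) (hb : b ≠ 0)
    (hbt : ∀ i, |b i| + m * S < R) (z : ℤ) :
    1 ≤ |(M.det : ℝ)| * |∑ i, (b i : ℝ) * η i + z| := by
  refine one_le_abs_det_mul hη b z (fun h0 => hb ?_) (hM.det_ne_zero hR)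
  obtain ⟨k, rfl⟩ := hg b ⟨-z, by push_cast; linarith⟩
  rw [hM.vecMul_eq_zero hR.le k hbt, Matrix.zero_vecMul]

/-- The extended matrix `[M | c]` has linearly dependent rows modulo `p`. -/
def SingMod {m : ℕ} (p : ℕ) (M : Matrix (Fin m) (Fin m) ℤ) (c : Fin m → ℤ) : Prop :=
  ∃ k : Fin m → ℤ, (∃ i, ¬ (p : ℤ) ∣ k i) ∧ (∀ j, (p : ℤ) ∣ (k ᵥ* M) j) ∧ (p : ℤ) ∣ ∑ i, k i * c i

lemma vecMul_dot {m : ℕ} {M : Matrix (Fin m) (Fin m) ℤ} {η : Fin m → ℝ} {c : Fin m → ℤ}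
    (hη : ∀ i, ∑ j, (M i j : ℝ) * η j = c i) (k : Fin m → ℤ) :
    ∑ j, ((k ᵥ* M) j : ℝ) * η j = ((∑ i, k i * c i : ℤ) : ℝ) := by
  push_cast
  simp_rw [← hη, Matrix.vecMul, dotProduct, Int.cast_sum, Finset.sum_mul, Finset.mul_sum]
  rw [Finset.sum_comm]
  simp [mul_assoc]

lemma exists_prime_singMod_of_not_goodCentre {m : ℕ} {M : Matrix (Fin m) (Fin m) ℤ}
    {η : Fin m → ℝ} {c : Fin m → ℤ} (hη : ∀ i, ∑ j, (M i j : ℝ) * η j = c i) (hdet : M.det ≠ 0)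
    (hg : ¬ GoodCentre M η) : ∃ p : ℕ, p.Prime ∧ SingMod p M c := by
  classical
  unfold GoodCentre at hg
  push Not at hg
  obtain ⟨b, ⟨z, hz⟩, hb⟩ := hg
  have hex : ∃ N : ℕ, 0 < N ∧ ∃ k : Fin m → ℤ, (N : ℤ) • b = k ᵥ* M := by
    refine ⟨M.det.natAbs, Int.natAbs_pos.2 hdet, (M.det.sign • (b ᵥ* M.adjugate)), ?_⟩
    rw [Matrix.smul_vecMul, Matrix.vecMul_vecMul, Matrix.adjugate_mul, Matrix.vecMul_smul,
      Matrix.vecMul_one, smul_smul, Int.natCast_natAbs, Int.sign_mul_self_eq_abs]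
  obtain ⟨hNpos, k, hk⟩ := Nat.find_spec hex
  set N := Nat.find hex with hN
  have hN1 : N ≠ 1 := by
    intro h1
    rw [h1] at hk
    exact hb k (by simpa using hk)
  obtain ⟨p, hp, N', hN'⟩ := Nat.exists_prime_and_dvd hN1
  have hN'pos : 0 < N' := Nat.pos_of_ne_zero fun h => by simp [h] at hN'; omega
  have hN'lt : N' < N := by
    rw [hN']; nlinarith [hp.two_le]
  have hb' : ¬ ∃ k : Fin m → ℤ, (N' : ℤ) • b = k ᵥ* M := fun h =>
    Nat.find_min hex hN'lt ⟨hN'pos, h⟩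
  have hpk : k ᵥ* M = (p : ℤ) • ((N' : ℤ) • b) := by
    rw [← hk, hN', smul_smul]; push_cast; rfl
  refine ⟨p, hp, k, ?_, fun j => ?_, ?_⟩
  · by_contra hall
    push Not at hall
    choose k' hk' using hall
    apply hb'
    refine ⟨k', ?_⟩
    have hkk : k = (p : ℤ) • k' := funext fun i => by simpa using hk' i
    rw [hkk, Matrix.smul_vecMul] at hpk
    exact (smul_right_injective _ (by exact_mod_cast hp.ne_zero : (p : ℤ) ≠ 0) hpk).symm
  · rw [hpk]; simp
  · have h1 := vecMul_dot hη k
    have h2 : ∑ j, ((k ᵥ* M) j : ℝ) * η j = ((p * (N' * z) : ℤ) : ℝ) := by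
      rw [hpk]
      push_cast
      rw [← hz, Finset.mul_sum, Finset.mul_sum]
      refine Finset.sum_congr rfl fun j _ => ?_
      simp; ring
    exact ⟨N' * z, by exact_mod_cast h1.symm.trans h2⟩

lemma SingMod.exists_denominator {m : ℕ} {M : Matrix (Fin m) (Fin m) ℤ}
    {η : Fin m → ℝ} {c : Fin m → ℤ} (hη : ∀ i, ∑ j, (M i j : ℝ) * η j = c i)
    {p : ℕ} (hp : p.Prime) (hs : SingMod p M c) :
    ∃ d : ℤ, (p : ℤ) * d = M.det ∧ ∀ i, ∃ a : ℤ, (d : ℝ) * η i = a := by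
  obtain ⟨k, ⟨i, hi⟩, hkM, e, he⟩ := hs
  choose b hb using hkM
  have hpp : Prime (p : ℤ) := Nat.prime_iff_prime_int.1 hp
  have hp0 : (p : ℝ) ≠ 0 := by exact_mod_cast hp.ne_zero
  have hbk : (p : ℤ) • b = k ᵥ* M := funext fun j => by simp [hb j]
  have hdet' : (p : ℤ) * (M.updateRow i b).det = k i * M.det := by
    rw [← Matrix.det_updateRow_smul, hbk, ← smul_eq_mul (k i), ← Matrix.det_updateRow_sum]
    congr 2
    rw [Matrix.vecMul_eq_sum]
  obtain ⟨d, hd⟩ := (hpp.dvd_or_dvd ⟨_, hdet'.symm⟩).resolve_left hi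
  refine ⟨d, hd.symm, fun l => ?_⟩
  have hη' : ∀ r, ∑ j, ((M.updateRow i b) r j : ℝ) * η j = (Function.update c i e) r := by
    intro r
    rcases eq_or_ne r i with rfl | hr
    · simp only [Matrix.updateRow_self, Function.update_self]
      have h1 := vecMul_dot hη k
      rw [he, ← hbk] at h1
      have h2 : (p : ℝ) * ∑ j, (b j : ℝ) * η j = p * e := by
        rw [Finset.mul_sum]
        push_cast at h1
        rw [← h1]
        refine Finset.sum_congr rfl fun j _ => ?_
        simp; ring
      exact mul_left_cancel₀ hp0 h2
    · simp [Matrix.updateRow_ne hr, Function.update_of_ne hr, hη]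
  have h1 := det_mul_eq_int hη l
  have h2 := det_mul_eq_int hη' l
  have h3 : (M.updateRow i b).det = k i * d := by
    have : (p : ℤ) * (M.updateRow i b).det = p * (k i * d) := by rw [hdet', hd]; ring
    exact mul_left_cancel₀ (by exact_mod_cast hp.ne_zero) this
  rw [h3] at h2
  rw [hd] at h1
  obtain ⟨u, v, huv⟩ : IsCoprime (p : ℤ) (k i) := (Prime.coprime_iff_not_dvd hpp).2 hi
  refine ⟨u * (M.adjugate *ᵥ c) l +
    v * ((M.updateRow i b).adjugate *ᵥ (Function.update c i e)) l, ?_⟩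
  push_cast at h1 h2 ⊢
  rw [← h1, ← h2]
  have huv' : (u : ℝ) * p + v * k i = 1 := by exact_mod_cast huv
  linear_combination (-(d : ℝ) * η l) * huv'

/-- The matrix with entries the representatives in `[0, S)` of the residues `W i (some j)`,
shifted by `R` on the diagonal. -/
def residueMatrix {m S : ℕ} (R : ℕ) (W : Fin m → Option (Fin m) → ZMod S) :
    Matrix (Fin m) (Fin m) ℤ :=
  fun i j => ((W i (some j)).val : ℤ) + if i = j then (R : ℤ) else 0

/-- The vector with entries the representatives in `[0, S)` of the residues `W i none`. -/
def residueVector {m S : ℕ} (W : Fin m → Option (Fin m) → ZMod S) : Fin m → ℤ :=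
  fun i => ((W i none).val : ℤ)

lemma residueMatrix_nearDiag {m S : ℕ} [NeZero S] (R : ℕ) (W : Fin m → Option (Fin m) → ZMod S) :
    NearDiag R S (residueMatrix R W) := fun i j => by
  have := ZMod.val_lt (W i (some j))
  unfold residueMatrix
  constructor <;> omega

/-- The number of solutions of `∑ i, k i * W i j = 0` modulo `p`. -/
lemma card_filter_sum_mul_eq_zero {m S p : ℕ} [NeZero S] [Fact p.Prime] (hpS : p ∣ S)
    (k : Fin m → ZMod p) (hk : k ≠ 0) :
    p ^ (m + 1) * (Finset.univ.filter fun W : Fin m → Option (Fin m) → ZMod S =>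
      ∀ j, ∑ i, k i * ZMod.castHom hpS (ZMod p) (W i j) = 0).card = S ^ (m * (m + 1)) := by
  classical
  let f : (Fin m → Option (Fin m) → ZMod S) →+ (Option (Fin m) → ZMod p) :=
    { toFun := fun W j => ∑ i, k i * ZMod.castHom hpS (ZMod p) (W i j)
      map_zero' := by ext; simp
      map_add' := fun a b => by
        funext j
        simp only [Pi.add_apply, map_add, mul_add, Finset.sum_add_distrib] }
  obtain ⟨i₀, hi₀⟩ := Function.ne_iff.1 hk
  have hf : Function.Surjective f := by
    intro y
    have hs := ZMod.castHom_surjective hpS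
    choose g hg using hs
    refine ⟨fun i j => if i = i₀ then g ((k i₀)⁻¹ * y j) else 0, ?_⟩
    funext j
    have hk0 : k i₀ ≠ 0 := hi₀
    change ∑ i, k i * ZMod.castHom hpS (ZMod p) (if i = i₀ then g ((k i₀)⁻¹ * y j) else 0) = y j
    rw [Finset.sum_eq_single i₀]
    · rw [if_pos rfl, hg, mul_inv_cancel_left₀ hk0]
    · intro b _ hb; simp [hb]
    · simp
  have h1 : ∀ y : Option (Fin m) → ZMod p,
      (Finset.univ.filter fun W => f W = y).card = (Finset.univ.filter fun W => f W = 0).card :=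
    fun y => AddMonoidHom.card_fiber_eq_of_mem_range f (hf y) (hf 0)
  have h2 := Finset.card_eq_sum_card_fiberwise (s := (Finset.univ : Finset (Fin m → Option (Fin m) → ZMod S)))
    (t := Finset.univ) (f := f) (fun _ _ => Finset.mem_coe.2 (Finset.mem_univ _))
  simp_rw [h1] at h2
  rw [Finset.sum_const, Finset.card_univ, Finset.card_univ, smul_eq_mul] at h2
  simp only [Fintype.card_fun, Fintype.card_option, Fintype.card_fin, ZMod.card] at h2
  have h3 : (Finset.univ.filter fun W : Fin m → Option (Fin m) → ZMod S =>
      ∀ j, ∑ i, k i * ZMod.castHom hpS (ZMod p) (W i j) = 0) =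
      Finset.univ.filter fun W => f W = 0 := by
    ext W
    simp only [Finset.mem_filter, Finset.mem_univ, true_and]
    exact ⟨fun h => funext h, fun h j => congrFun h j⟩
  rw [h3, ← h2, ← pow_mul, mul_comm]

open Classical in
lemma card_singMod_le {m S p R : ℕ} [NeZero S] (hp : p.Prime) (hpS : p ∣ S) (hpR : p ∣ R) :
    p * (p - 1) * (Finset.univ.filter fun W : Fin m → Option (Fin m) → ZMod S =>
      SingMod p (residueMatrix R W) (residueVector W)).card ≤ S ^ (m * (m + 1)) := by
  have : Fact p.Prime := ⟨hp⟩
  set r := ZMod.castHom hpS (ZMod p)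
  let P : (Fin m → Option (Fin m) → ZMod S) → (Fin m → ZMod p) → Prop := fun W k =>
    ∀ j, ∑ i, k i * r (W i j) = 0
  set bad := Finset.univ.filter fun W : Fin m → Option (Fin m) → ZMod S =>
      SingMod p (residueMatrix R W) (residueVector W)
  set K := Finset.univ.filter fun k : Fin m → ZMod p => k ≠ 0
  have hrval : ∀ x : ZMod S, r x = ((x.val : ℤ) : ZMod p) := fun x => by
    simp only [r, ZMod.castHom_apply, Int.cast_natCast]
    exact ZMod.cast_eq_val x
  have h1 : ∀ W ∈ bad, p - 1 ≤ (K.filter fun k => P W k).card := by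
    intro W hW
    obtain ⟨k, ⟨i₀, hi₀⟩, hkM, hkc⟩ := (Finset.mem_filter.1 hW).2
    have hk0 : ((k i₀ : ℤ) : ZMod p) ≠ 0 := fun h => hi₀ ((ZMod.intCast_zmod_eq_zero_iff_dvd _ _).1 h)
    have hP : P W (fun i => (k i : ZMod p)) := by
      intro j
      cases j with
      | none =>
        have := (ZMod.intCast_zmod_eq_zero_iff_dvd _ p).2 hkc
        simp only [residueVector, Int.cast_sum, Int.cast_mul] at this
        simpa only [hrval] using this
      | some j =>
        have := (ZMod.intCast_zmod_eq_zero_iff_dvd _ p).2 (hkM j)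
        simp only [residueMatrix, Matrix.vecMul, dotProduct, Int.cast_sum, Int.cast_mul,
          Int.cast_add] at this
        simp only [hrval]
        rw [← this]
        refine Finset.sum_congr rfl fun i _ => ?_
        have : (R : ZMod p) = 0 := (ZMod.natCast_eq_zero_iff _ _).2 hpR
        split_ifs <;> simp [this]
    calc p - 1 = Fintype.card (ZMod p)ˣ := (ZMod.card_units p).symm
      _ = (Finset.univ : Finset (ZMod p)ˣ).card := rfl
      _ ≤ _ := by
        refine Finset.card_le_card_of_injOn (fun u i => (u : ZMod p) * (k i : ZMod p)) ?_ ?_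
        · intro u _
          simp only [Finset.coe_filter, Set.mem_ofPred_eq, K, Finset.mem_filter, Finset.mem_univ, true_and]
          refine ⟨fun h => ?_, fun j => ?_⟩
          · have := congrFun h i₀
            simp [hk0] at this
          · have := hP j
            simp_rw [mul_assoc]
            rw [← Finset.mul_sum, this, mul_zero]
        · intro u _ v _ huv
          exact Units.ext (mul_right_cancel₀ hk0 (congrFun huv i₀))
  have h2 : bad.card * (p - 1) ≤ ∑ W ∈ bad, (K.filter fun k => P W k).card := by
    simpa using Finset.card_nsmul_le_sum bad _ _ h1
  have h3 : ∑ W ∈ bad, (K.filter fun k => P W k).card ≤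
      ∑ k ∈ K, (Finset.univ.filter fun W => P W k).card := by
    have e := Finset.sum_card_bipartiteAbove_eq_sum_card_bipartiteBelow (s := bad) (t := K) P
    simp only [Finset.bipartiteAbove, Finset.bipartiteBelow] at e
    rw [e]
    exact Finset.sum_le_sum fun k _ => Finset.card_le_card (Finset.filter_subset_filter _ (Finset.subset_univ _))
  have h4 : p ^ (m + 1) * ∑ k ∈ K, (Finset.univ.filter fun W => P W k).card ≤
      p ^ m * S ^ (m * (m + 1)) := by
    rw [Finset.mul_sum]
    calc _ = ∑ _k ∈ K, S ^ (m * (m + 1)) := Finset.sum_congr rfl fun k hk =>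
          card_filter_sum_mul_eq_zero hpS k (Finset.mem_filter.1 hk).2
      _ = K.card * S ^ (m * (m + 1)) := by simp
      _ ≤ _ := by
        gcongr
        calc K.card ≤ Fintype.card (Fin m → ZMod p) := Finset.card_le_univ _
          _ = p ^ m := by simp
  have h5 : p ^ m * (p * (p - 1) * bad.card) ≤ p ^ m * S ^ (m * (m + 1)) := by
    refine le_trans ?_ h4
    calc _ = p ^ (m + 1) * (bad.card * (p - 1)) := by ring
      _ ≤ _ := Nat.mul_le_mul_left _ (h2.trans h3)
  exact Nat.le_of_mul_le_mul_left h5 (pow_pos hp.pos m)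

lemma sum_prime_inv_le (Y : ℕ) :
    ∑ p ∈ (Finset.range (Y + 1)).filter Nat.Prime, (1 : ℝ) / (p * (p - 1)) ≤ 11 / 12 := by
  have key : ∀ Y : ℕ, ∑ p ∈ (Finset.range (Y + 5)).filter Nat.Prime, (1 : ℝ) / (p * (p - 1)) ≤
      11 / 12 - 1 / (Y + 4) := by
    intro Y
    induction Y with
    | zero =>
      have : (Finset.range (0 + 5)).filter Nat.Prime = {2, 3} := by decide
      rw [this]; norm_num
    | succ Y ih =>
      rw [show Y + 1 + 5 = (Y + 5) + 1 by ring, Finset.range_add_one, Finset.filter_insert]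
      have hY : (0 : ℝ) ≤ Y := Nat.cast_nonneg Y
      have h1 : (1 : ℝ) / ((Y + 5) * (Y + 4)) = 1 / (Y + 4) - 1 / (Y + 5) := by
        field_simp; ring
      have h2 : (0 : ℝ) ≤ (1 : ℝ) / ((Y + 5) * (Y + 4)) := by positivity
      split_ifs
      · rw [Finset.sum_insert (by simp)]
        push_cast
        rw [show (Y : ℝ) + 5 - 1 = Y + 4 by ring, show (Y : ℝ) + 1 + 4 = Y + 5 by ring]
        linarith
      · push_cast
        rw [show (Y : ℝ) + 1 + 4 = Y + 5 by ring]
        linarith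
  have h := key Y
  have hY : (0 : ℝ) ≤ 1 / ((Y : ℝ) + 4) := by positivity
  refine le_trans (Finset.sum_le_sum_of_subset_of_nonneg ?_ ?_) (h.trans (by linarith))
  · exact Finset.filter_subset_filter _ (Finset.range_subset_range.2 (by omega))
  · intro p hp _
    have : (1 : ℝ) ≤ p := by exact_mod_cast (Finset.mem_filter.1 hp).2.one_lt.le
    have : (0 : ℝ) ≤ p - 1 := by linarith
    positivity

/-- `q` is a common denominator of the coordinates of `η`. -/
def IsCommonDenom {m : ℕ} (η : Fin m → ℝ) (q : ℕ) : Prop :=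
  0 < q ∧ ∀ i, ∃ a : ℤ, (q : ℝ) * η i = a

/-- If `q` is the least common denominator of `a / q`, then `b ↦ a · b` is onto modulo `q`. -/
lemma exists_dot_eq_of_minimal {m q : ℕ} {η : Fin m → ℝ} {a : Fin m → ℤ}
    (hq : 0 < q) (ha : ∀ i, (q : ℝ) * η i = a i) (hmin : ∀ q', IsCommonDenom η q' → q ≤ q')
    (x : ZMod q) : ∃ b : Fin m → ℤ, ((∑ i, a i * b i : ℤ) : ZMod q) = x := by
  have : NeZero q := ⟨hq.ne'⟩
  let f : (Fin m → ℤ) →+ ZMod q :=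
    { toFun := fun b => ((∑ i, a i * b i : ℤ) : ZMod q)
      map_zero' := by simp
      map_add' := fun b b' => by
        simp only [Pi.add_apply, mul_add, Finset.sum_add_distrib, Int.cast_add] }
  have hcard : q ≤ Nat.card f.range := by
    refine hmin _ ⟨Nat.card_pos, fun i => ?_⟩
    have h1 : Nat.card f.range • f (Pi.single i 1) = 0 := by
      have := congrArg (Subtype.val) (card_nsmul_eq_zero' (x := (⟨f (Pi.single i 1), _, rfl⟩ : f.range)))
      simpa using this
    have h2 : f (Pi.single i 1) = (a i : ZMod q) := by
      simp [f, Pi.single_apply]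
    rw [h2, nsmul_eq_mul] at h1
    have h3 : ((Nat.card f.range * a i : ℤ) : ZMod q) = 0 := by push_cast; exact h1
    obtain ⟨e, he⟩ := (ZMod.intCast_zmod_eq_zero_iff_dvd _ _).1 h3
    refine ⟨e, ?_⟩
    have hq0 : (q : ℝ) ≠ 0 := by exact_mod_cast hq.ne'
    apply mul_left_cancel₀ hq0
    have he' : ((Nat.card f.range : ℝ)) * a i = q * e := by exact_mod_cast he
    rw [← he', ← ha i]; ring
  have htop : f.range = ⊤ := by
    apply AddSubgroup.eq_top_of_le_card
    rwa [Nat.card_eq_fintype_card, ZMod.card]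
  have : x ∈ f.range := by rw [htop]; trivial
  exact this

/-- Reduction modulo the rows of `M`. -/
lemma NearDiag.exists_reduced {m R S : ℕ} {M : Matrix (Fin m) (Fin m) ℤ} (h : NearDiag R S M)
    (hdet : M.det ≠ 0) (v : Fin m → ℤ) :
    ∃ k : Fin m → ℤ, ∀ j, |(v - k ᵥ* M) j| ≤ R + m * S := by
  set A : Matrix (Fin m) (Fin m) ℝ := M.map (Int.castRingHom ℝ) with hA
  have hAdet : IsUnit A.det := by
    rw [hA, ← RingHom.mapMatrix_apply, ← RingHom.map_det]
    exact isUnit_iff_ne_zero.2 (by simpa using hdet)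
  set lam : Fin m → ℝ := (fun i => (v i : ℝ)) ᵥ* A⁻¹ with hlam
  refine ⟨fun i => ⌊lam i⌋, fun j => ?_⟩
  have hv : (v j : ℝ) = ∑ i, lam i * (M i j : ℝ) := by
    have : lam ᵥ* A = fun i => (v i : ℝ) := by
      rw [hlam, Matrix.vecMul_vecMul, Matrix.nonsing_inv_mul _ hAdet, Matrix.vecMul_one]
    have := congrFun this j
    simpa [Matrix.vecMul, dotProduct, hA] using this.symm
  have h2 : (((v - (fun i => ⌊lam i⌋) ᵥ* M) j : ℤ) : ℝ) = ∑ i, Int.fract (lam i) * (M i j : ℝ) := by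
    simp only [Pi.sub_apply, Int.cast_sub, hv, Matrix.vecMul, dotProduct, Int.cast_sum, Int.cast_mul]
    rw [← Finset.sum_sub_distrib]
    exact Finset.sum_congr rfl fun i _ => by rw [Int.fract]; ring
  have h3 : |(((v - (fun i => ⌊lam i⌋) ᵥ* M) j : ℤ) : ℝ)| ≤ R + m * S := by
    rw [h2]
    refine (Finset.abs_sum_le_sum_abs _ _).trans (le_trans ?_ (h.transpose.sum_le j))
    refine Finset.sum_le_sum fun i _ => ?_
    rw [abs_mul, Matrix.transpose_apply, abs_of_nonneg (Int.fract_nonneg _)]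
    exact mul_le_of_le_one_left (abs_nonneg _) (Int.fract_lt_one _).le
  exact_mod_cast h3

/-- The number of possible rows in a box is controlled by the least common denominator. -/
lemma NearDiag.card_rows_le {m R S q : ℕ} {M : Matrix (Fin m) (Fin m) ℤ} {η : Fin m → ℝ}
    {c a : Fin m → ℤ} (hM : NearDiag R S M) (hη : ∀ i, ∑ j, (M i j : ℝ) * η j = c i)
    (hdet : M.det ≠ 0) (hq : 0 < q) (ha : ∀ i, (q : ℝ) * η i = a i)
    (hmin : ∀ q', IsCommonDenom η q' → q ≤ q') :
    q * ((Fintype.piFinset fun _ : Fin m => Finset.Ico (0 : ℤ) (R + m * S)).filter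
      fun r => (q : ℤ) ∣ ∑ i, a i * r i).card ≤ (3 * (R + m * S)) ^ m := by
  classical
  have : NeZero q := ⟨hq.ne'⟩
  have hrow : ∀ k : Fin m → ℤ, ((∑ j, a j * (k ᵥ* M) j : ℤ) : ZMod q) = 0 := by
    intro k
    rw [ZMod.intCast_zmod_eq_zero_iff_dvd]
    refine ⟨∑ i, k i * c i, ?_⟩
    have h1 := vecMul_dot hη k
    have : ((∑ j, a j * (k ᵥ* M) j : ℤ) : ℝ) = ((q * ∑ i, k i * c i : ℤ) : ℝ) := by
      rw [Int.cast_mul, ← h1, Finset.mul_sum]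
      push_cast
      exact Finset.sum_congr rfl fun j _ => by rw [← ha j]; ring
    exact_mod_cast this
  have hrep : ∀ x : ZMod q, ∃ v : Fin m → ℤ, (∀ j, |v j| ≤ R + m * S) ∧
      ((∑ i, a i * v i : ℤ) : ZMod q) = x := by
    intro x
    obtain ⟨b, hb⟩ := exists_dot_eq_of_minimal hq ha hmin x
    obtain ⟨k, hk⟩ := hM.exists_reduced hdet b
    refine ⟨_, hk, ?_⟩
    simp only [Pi.sub_apply, mul_sub, Finset.sum_sub_distrib, Int.cast_sub, hb, hrow, sub_zero]
  choose v hvB hvx using hrep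
  set T := (Fintype.piFinset fun _ : Fin m => Finset.Ico (0 : ℤ) (R + m * S)).filter
      fun r => (q : ℤ) ∣ ∑ i, a i * r i with hT
  have key : ((Finset.univ : Finset (ZMod q)) ×ˢ T).card ≤
      (Fintype.piFinset fun _ : Fin m => Finset.Ico (-(R + m * S) : ℤ) (2 * (R + m * S))).card := by
    refine Finset.card_le_card_of_injOn (fun z => v z.1 + z.2) ?_ ?_
    · rintro ⟨x, r⟩ hz
      have hr := (Finset.mem_filter.1 (Finset.mem_product.1 (Finset.mem_coe.1 hz)).2).1
      rw [Fintype.mem_piFinset] at hr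
      rw [Finset.mem_coe, Fintype.mem_piFinset]
      intro j
      have h1 := Finset.mem_Ico.1 (hr j)
      have h2 := _root_.abs_le.1 (hvB x j)
      simp only [Pi.add_apply, Finset.mem_Ico]
      constructor <;> linarith [h1.1, h1.2, h2.1, h2.2]
    · rintro ⟨x, r⟩ hz ⟨x', r'⟩ hz' heq
      have hr := (Finset.mem_filter.1 (Finset.mem_product.1 (Finset.mem_coe.1 hz)).2).2
      have hr' := (Finset.mem_filter.1 (Finset.mem_product.1 (Finset.mem_coe.1 hz')).2).2
      have e : ∀ x r, (q : ℤ) ∣ ∑ i, a i * r i →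
          ((∑ i, a i * (v x + r) i : ℤ) : ZMod q) = x := by
        intro x r hr
        simp only [Pi.add_apply, mul_add, Finset.sum_add_distrib, Int.cast_add, hvx,
          (ZMod.intCast_zmod_eq_zero_iff_dvd _ _).2 hr, add_zero]
      have hx : x = x' := by
        rw [← e x r hr, ← e x' r' hr']
        exact congrArg (fun w : Fin m → ℤ => ((∑ i, a i * w i : ℤ) : ZMod q)) heq
      subst hx
      simpa using heq
  rw [Finset.card_product, Finset.card_univ, ZMod.card, Fintype.card_piFinset] at key
  refine key.trans (le_of_eq ?_)
  simp only [Int.card_Ico, Finset.prod_const, Finset.card_univ, Fintype.card_fin]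
  congr 1
  omega

/-- The solution of `M η = c` for the extended matrix `[M | c]` attached to `W`. -/
noncomputable def centre {m S : ℕ} (R : ℕ) (W : Fin m → Option (Fin m) → ZMod S) : Fin m → ℝ :=
  ((residueMatrix R W).map (Int.castRingHom ℝ))⁻¹ *ᵥ fun i => (residueVector W i : ℝ)

lemma centre_spec {m S R : ℕ} [NeZero S] (hR : m * S < R) (W : Fin m → Option (Fin m) → ZMod S)
    (i : Fin m) :
    ∑ j, (residueMatrix R W i j : ℝ) * centre R W j = residueVector W i := by
  have hdet := (residueMatrix_nearDiag R W).det_ne_zero hR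
  have hAdet : IsUnit ((residueMatrix R W).map (Int.castRingHom ℝ)).det := by
    rw [← RingHom.mapMatrix_apply, ← RingHom.map_det]
    exact isUnit_iff_ne_zero.2 (by simpa using hdet)
  have : ((residueMatrix R W).map (Int.castRingHom ℝ)) *ᵥ centre R W =
      fun i => (residueVector W i : ℝ) := by
    rw [centre, Matrix.mulVec_mulVec, Matrix.mul_nonsing_inv _ hAdet, Matrix.one_mulVec]
  simpa [Matrix.mulVec, dotProduct] using congrFun this i

lemma residueVector_bounds {m S : ℕ} [NeZero S] (W : Fin m → Option (Fin m) → ZMod S) (i : Fin m) :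
    0 ≤ residueVector W i ∧ residueVector W i < S := by
  have := ZMod.val_lt (W i none)
  unfold residueVector
  constructor <;> omega

lemma abs_centre_le {m S R : ℕ} [NeZero S] (hR : (m + 1) * S ≤ R)
    (W : Fin m → Option (Fin m) → ZMod S) (i : Fin m) : |centre R W i| ≤ 1 := by
  have hS : 0 < S := NeZero.pos S
  have hR' : m * S < R := by nlinarith
  have h := (residueMatrix_nearDiag R W).dominance hR'.le (centre R W) S (fun i => by
    rw [centre_spec hR' W i, ← Int.cast_abs]
    obtain ⟨h1, h2⟩ := residueVector_bounds W i
    rw [abs_of_nonneg h1]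
    exact_mod_cast h2.le) i
  have h1 : ((m : ℝ) + 1) * S ≤ R := by exact_mod_cast hR
  have h2 : (0 : ℝ) < S := by exact_mod_cast hS
  nlinarith [abs_nonneg (centre R W i)]

lemma residue_injective {m S R : ℕ} [NeZero S] {W W' : Fin m → Option (Fin m) → ZMod S}
    (hM : residueMatrix R W = residueMatrix R W') (hc : residueVector W = residueVector W') :
    W = W' := by
  funext i j
  cases j with
  | none => 
    have := congrFun hc i
    simp only [residueVector] at this
    exact ZMod.val_injective _ (by exact_mod_cast this)
  | some j => 
    have := congrFun (congrFun hM i) j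
    simp only [residueMatrix, add_left_inj] at this
    exact ZMod.val_injective _ (by exact_mod_cast this)

open Classical in
lemma card_exists_commonDenom_le {m S R : ℕ} [NeZero S] (hR : (m + 1) * S ≤ R) (Q : ℕ) :
    (Finset.univ.filter fun W : Fin m → Option (Fin m) → ZMod S =>
      ∃ q ≤ Q, IsCommonDenom (centre R W) q).card ≤
      Q * (3 ^ m * (3 * (R + m * S)) ^ (m * m)) := by
  have hS : 0 < S := NeZero.pos S
  have hR' : m * S < R := by nlinarith
  let F : ℕ → (Fin m → ℤ) → Finset (Fin m → Option (Fin m) → ZMod S) := fun q a =>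
    Finset.univ.filter fun W => (0 < q ∧ ∀ i, (q : ℝ) * centre R W i = a i) ∧
      ∀ q', IsCommonDenom (centre R W) q' → q ≤ q'
  have hF : ∀ q a, q ^ m * (F q a).card ≤ (3 * (R + m * S)) ^ (m * m) := by
    intro q a
    rcases (F q a).eq_empty_or_nonempty with h | ⟨W₀, hW₀⟩
    · simp [h]
    obtain ⟨⟨hq, ha⟩, hmin⟩ := (Finset.mem_filter.1 hW₀).2
    have h1 := (residueMatrix_nearDiag R W₀).card_rows_le (centre_spec hR' W₀)
      ((residueMatrix_nearDiag R W₀).det_ne_zero hR') hq ha hmin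
    set T := (Fintype.piFinset fun _ : Fin m => Finset.Ico (0 : ℤ) (R + m * S)).filter
      fun r => (q : ℤ) ∣ ∑ i, a i * r i with hT
    have hrow : ∀ W ∈ F q a, ∀ i,
        (∑ j, a j * residueMatrix R W i j : ℤ) = q * residueVector W i := by
      intro W hW i
      obtain ⟨⟨-, ha⟩, -⟩ := (Finset.mem_filter.1 hW).2
      have : ((∑ j, a j * residueMatrix R W i j : ℤ) : ℝ) = ((q * residueVector W i : ℤ) : ℝ) := by
        push_cast
        rw [← centre_spec hR' W i, Finset.mul_sum]
        exact Finset.sum_congr rfl fun j _ => by rw [← ha j]; ring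
      exact_mod_cast this
    have h2 : (F q a).card ≤ (Fintype.piFinset fun _ : Fin m => T).card := by
      refine Finset.card_le_card_of_injOn (fun W i j => residueMatrix R W i j) ?_ ?_
      · intro W hW
        rw [Finset.mem_coe, Fintype.mem_piFinset]
        intro i
        rw [hT, Finset.mem_filter, Fintype.mem_piFinset]
        refine ⟨fun j => ?_, ⟨_, hrow W hW i⟩⟩
        obtain ⟨e1, e2⟩ := residueMatrix_nearDiag R W i j
        rw [Finset.mem_Ico]
        have hm : 0 < m := i.pos
        have : (S : ℤ) ≤ m * S := by exact_mod_cast Nat.le_mul_of_pos_left S hm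
        split_ifs at e1 e2 <;> constructor <;> linarith
      · intro W hW W' hW' heq
        have heq' : residueMatrix R W = residueMatrix R W' := heq
        refine residue_injective heq' (funext fun i => ?_)
        have e1 := hrow W hW i
        have e2 := hrow W' hW' i
        rw [heq', e2] at e1
        exact (mul_left_cancel₀ (by exact_mod_cast hq.ne') e1).symm
    rw [Fintype.card_piFinset, Finset.prod_const, Finset.card_univ, Fintype.card_fin] at h2
    calc q ^ m * (F q a).card ≤ q ^ m * T.card ^ m := Nat.mul_le_mul_left _ h2
      _ = (q * T.card) ^ m := (mul_pow _ _ _).symm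
      _ ≤ ((3 * (R + m * S)) ^ m) ^ m := Nat.pow_le_pow_left h1 _
      _ = _ := (pow_mul _ _ _).symm
  have hsub : (Finset.univ.filter fun W : Fin m → Option (Fin m) → ZMod S =>
      ∃ q ≤ Q, IsCommonDenom (centre R W) q) ⊆
      (Finset.Icc 1 Q).biUnion fun q =>
        (Fintype.piFinset fun _ : Fin m => Finset.Icc (-q : ℤ) q).biUnion fun a => F q a := by
    intro W hW
    obtain ⟨q₁, hq₁, hd⟩ := (Finset.mem_filter.1 hW).2
    have hex : ∃ q, IsCommonDenom (centre R W) q := ⟨q₁, hd⟩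
    have hspec := Nat.find_spec hex
    have hle := Nat.find_min' hex hd
    set q := Nat.find hex with hq
    obtain ⟨hq0, ha⟩ := hspec
    choose a ha using ha
    simp only [Finset.mem_biUnion, Finset.mem_Icc]
    refine ⟨q, ⟨hq0, hle.trans hq₁⟩, a, ?_, Finset.mem_filter.2 ⟨Finset.mem_univ _, ⟨hq0, ha⟩,
      fun q' h => Nat.find_min' hex h⟩⟩
    rw [Fintype.mem_piFinset]
    intro i
    have h1 := abs_centre_le hR W i
    have h2 : |(a i : ℝ)| ≤ q := by
      rw [← ha i, abs_mul, Nat.abs_cast]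
      exact mul_le_of_le_one_right (Nat.cast_nonneg _) h1
    have h3 : |a i| ≤ q := by exact_mod_cast h2
    exact Finset.mem_Icc.2 (_root_.abs_le.1 h3)
  refine (Finset.card_le_card hsub).trans (Finset.card_biUnion_le.trans ?_)
  calc _ ≤ ∑ _q ∈ Finset.Icc 1 Q, 3 ^ m * (3 * (R + m * S)) ^ (m * m) := by
        refine Finset.sum_le_sum fun q hq => ?_
        have hq1 := (Finset.mem_Icc.1 hq).1
        have h1 : q ^ m * ((Fintype.piFinset fun _ : Fin m => Finset.Icc (-q : ℤ) q).biUnion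
            fun a => F q a).card ≤ q ^ m * (3 ^ m * (3 * (R + m * S)) ^ (m * m)) := by
          calc _ ≤ q ^ m * ∑ a ∈ Fintype.piFinset fun _ : Fin m => Finset.Icc (-q : ℤ) q,
                  (F q a).card := Nat.mul_le_mul_left _ Finset.card_biUnion_le
            _ ≤ ∑ _a ∈ Fintype.piFinset fun _ : Fin m => Finset.Icc (-q : ℤ) q,
                  (3 * (R + m * S)) ^ (m * m) := by
                rw [Finset.mul_sum]
                exact Finset.sum_le_sum fun a _ => hF q a
            _ = (2 * q + 1) ^ m * (3 * (R + m * S)) ^ (m * m) := by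
                simp only [Finset.sum_const, Fintype.card_piFinset, Finset.prod_const,
                  Finset.card_univ, Fintype.card_fin, Int.card_Icc, smul_eq_mul]
                congr 2
                omega
            _ ≤ (3 * q) ^ m * (3 * (R + m * S)) ^ (m * m) := by
                gcongr; omega
            _ = _ := by rw [mul_pow]; ring
        exact Nat.le_of_mul_le_mul_left h1 (pow_pos hq1 m)
    _ = _ := by simp

open Classical in
/-- A positive proportion of the extended matrices gives good centres. -/
lemma card_goodCentre_ge {m L S Y : ℕ} [NeZero S] (hL : m + 1 ≤ L)
    (hY : Y = 24 * (3 * (L + m)) ^ (m * (m + 1))) (hS : Y.factorial ∣ S) :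
    S ^ (m * (m + 1)) ≤ 24 * (Finset.univ.filter fun W : Fin m → Option (Fin m) → ZMod S =>
      GoodCentre (residueMatrix (L * S) W) (centre (L * S) W)).card := by
  set R := L * S with hRdef
  have hS0 : 0 < S := NeZero.pos S
  have hR : (m + 1) * S ≤ R := Nat.mul_le_mul_right S hL
  have hR' : m * S < R := by nlinarith
  have hYpos : 0 < Y := by rw [hY]; have : 0 < L := by omega
                           positivity
  set N := S ^ (m * (m + 1)) with hN
  set good := Finset.univ.filter fun W : Fin m → Option (Fin m) → ZMod S =>
      GoodCentre (residueMatrix R W) (centre R W)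
  set sing : ℕ → Finset (Fin m → Option (Fin m) → ZMod S) := fun p =>
    Finset.univ.filter fun W => SingMod p (residueMatrix R W) (residueVector W)
  set Q := (R + m * S) ^ m / Y with hQ
  set big := Finset.univ.filter fun W : Fin m → Option (Fin m) → ZMod S =>
      ∃ q ≤ Q, IsCommonDenom (centre R W) q
  have hcover : (Finset.univ : Finset (Fin m → Option (Fin m) → ZMod S)) ⊆
      good ∪ (((Finset.range (Y + 1)).filter Nat.Prime).biUnion sing ∪ big) := by
    intro W _
    by_cases hg : GoodCentre (residueMatrix R W) (centre R W)
    · exact Finset.mem_union_left _ (Finset.mem_filter.2 ⟨Finset.mem_univ _, hg⟩)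
    apply Finset.mem_union_right
    have hdet := (residueMatrix_nearDiag R W).det_ne_zero hR'
    obtain ⟨p, hp, hs⟩ := exists_prime_singMod_of_not_goodCentre (centre_spec hR' W) hdet hg
    by_cases hpY : p ≤ Y
    · apply Finset.mem_union_left
      simp only [Finset.mem_biUnion, Finset.mem_filter, Finset.mem_range]
      exact ⟨p, ⟨by omega, hp⟩, Finset.mem_filter.2 ⟨Finset.mem_univ _, hs⟩⟩
    · apply Finset.mem_union_right
      obtain ⟨d, hd, ha⟩ := hs.exists_denominator (centre_spec hR' W) hp
      have hd0 : d ≠ 0 := by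
        rintro rfl
        exact hdet (by simpa using hd.symm)
      refine Finset.mem_filter.2 ⟨Finset.mem_univ _, d.natAbs, ?_, Int.natAbs_pos.2 hd0, fun i => ?_⟩
      · rw [hQ, Nat.le_div_iff_mul_le hYpos]
        have h1 := (residueMatrix_nearDiag R W).abs_det_le
        have h2 : ((d.natAbs * p : ℕ) : ℝ) ≤ ((R + m * S) ^ m : ℕ) := by
          rw [← hd] at h1
          push_cast at h1 ⊢
          rw [abs_mul, Nat.abs_cast, mul_comm] at h1
          rwa [Nat.cast_natAbs, Int.cast_abs]
        have h3 : d.natAbs * p ≤ (R + m * S) ^ m := by exact_mod_cast h2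
        exact le_trans (Nat.mul_le_mul_left _ (by omega)) h3
      · obtain ⟨a, ha⟩ := ha i
        rcases Int.natAbs_eq d with h | h
        · exact ⟨a, by rw [← ha]; congr 1; rw [h]; simp⟩
        · refine ⟨-a, ?_⟩
          rw [Int.cast_neg, ← ha, ← neg_mul]
          congr 1
          rw [h]; simp
  have h1 := (Finset.card_le_card hcover).trans ((Finset.card_union_le _ _).trans
    (Nat.add_le_add_left (Finset.card_union_le _ _) _))
  have hcardN : (Finset.univ : Finset (Fin m → Option (Fin m) → ZMod S)).card = N := by
    rw [Finset.card_univ]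
    simp only [Fintype.card_fun, Fintype.card_option, Fintype.card_fin, ZMod.card]
    rw [hN, ← pow_mul, mul_comm]
  rw [hcardN] at h1
  have hbig : 24 * big.card ≤ N := by
    have h2 : Y * big.card ≤ (3 * (L + m)) ^ (m * (m + 1)) * N := by
      calc Y * big.card ≤ Y * (Q * (3 ^ m * (3 * (R + m * S)) ^ (m * m))) :=
            Nat.mul_le_mul_left _ (card_exists_commonDenom_le hR Q)
        _ = (Y * Q) * (3 ^ m * (3 * (R + m * S)) ^ (m * m)) := by ring
        _ ≤ (R + m * S) ^ m * (3 ^ m * (3 * (R + m * S)) ^ (m * m)) :=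
            Nat.mul_le_mul_right _ (Nat.mul_div_le _ _)
        _ = (3 * (R + m * S)) ^ (m * (m + 1)) := by
            rw [← mul_assoc, mul_comm (_ ^ m) (3 ^ m), ← mul_pow, ← pow_add]
            congr 1; ring
        _ = _ := by
            rw [hN, ← mul_pow, hRdef]
            congr 1; ring
    rw [hY] at h2
    have hpos : 0 < (3 * (L + m)) ^ (m * (m + 1)) := by
      have : 0 < L := by omega
      positivity
    refine Nat.le_of_mul_le_mul_left (le_trans (le_of_eq ?_) h2) hpos
    ring
  have hsing : ((((Finset.range (Y + 1)).filter Nat.Prime).biUnion sing).card : ℝ) ≤ 11 / 12 * N := by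
    calc ((((Finset.range (Y + 1)).filter Nat.Prime).biUnion sing).card : ℝ)
        ≤ ∑ p ∈ (Finset.range (Y + 1)).filter Nat.Prime, ((sing p).card : ℝ) := by
          exact_mod_cast Finset.card_biUnion_le
      _ ≤ ∑ p ∈ (Finset.range (Y + 1)).filter Nat.Prime, (1 : ℝ) / (p * (p - 1)) * N := by
          refine Finset.sum_le_sum fun p hp => ?_
          obtain ⟨hpr, hpp⟩ := Finset.mem_filter.1 hp
          have hpY : p ≤ Y := by have := Finset.mem_range.1 hpr; omega
          have hpS : p ∣ S := (Nat.dvd_factorial hpp.pos hpY).trans hS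
          have h2 := card_singMod_le (m := m) (R := R) hpp hpS (hpS.mul_left L)
          have h3 : ((p * (p - 1) * (sing p).card : ℕ) : ℝ) ≤ N := by exact_mod_cast h2
          rw [Nat.cast_mul, Nat.cast_mul, Nat.cast_sub hpp.one_lt.le, Nat.cast_one] at h3
          have h4 : (2 : ℝ) ≤ p := by exact_mod_cast hpp.two_le
          have h5 : (0 : ℝ) < p * (p - 1) := by nlinarith
          rw [div_mul_eq_mul_div, one_mul, le_div_iff₀ h5, mul_comm]
          exact h3
      _ ≤ 11 / 12 * N := by
          rw [← Finset.sum_mul]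
          exact mul_le_mul_of_nonneg_right (sum_prime_inv_le Y) (Nat.cast_nonneg _)
  have h1' : (N : ℝ) ≤ good.card +
      ((((Finset.range (Y + 1)).filter Nat.Prime).biUnion sing).card + big.card) := by
    exact_mod_cast h1
  have hbig' : (24 : ℝ) * big.card ≤ N := by exact_mod_cast hbig
  have : (N : ℝ) ≤ 24 * good.card := by linarith
  exact_mod_cast this

lemma abs_sum_mul_le {m : ℕ} (f x : Fin m → ℝ) {B ε : ℝ} (hf : ∑ i, |f i| ≤ B)
    (hx : ∀ i, |x i| ≤ ε) (hε : 0 ≤ ε) : |∑ i, f i * x i| ≤ B * ε := by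
  calc |∑ i, f i * x i| ≤ ∑ i, |f i| * ε := (Finset.abs_sum_le_sum_abs _ _).trans
        (Finset.sum_le_sum fun i _ => by
          rw [abs_mul]; exact mul_le_mul_of_nonneg_left (hx i) (abs_nonneg _))
    _ = (∑ i, |f i|) * ε := (Finset.sum_mul _ _ _).symm
    _ ≤ B * ε := mul_le_mul_of_nonneg_right hf hε

/-- Integer translates of distinct good centres are separated. -/
lemma centre_separated {m S R : ℕ} [NeZero S] (hR : (m + 1) * S < R)
    {W W' : Fin m → Option (Fin m) → ZMod S} {z z' : Fin m → ℤ}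
    (hg : GoodCentre (residueMatrix R W) (centre R W)) {ε : ℝ} (hε0 : 0 ≤ ε)
    (hε : ∀ i, |centre R W i + z i - (centre R W' i + z' i)| ≤ ε)
    (hsmall : ((R : ℝ) + m * S) ^ m * (((R : ℝ) + m * S) * ε) < 1) : W = W' ∧ z = z' := by
  have hS : 0 < S := NeZero.pos S
  have hR' : m * S < R := by nlinarith
  set M := residueMatrix R W with hMdef
  set M' := residueMatrix R W' with hMdef'
  have hM : NearDiag R S M := residueMatrix_nearDiag R W
  have hM' : NearDiag R S M' := residueMatrix_nearDiag R W'
  have hB1 : (1 : ℝ) ≤ (R : ℝ) + m * S := by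
    have : (1 : ℝ) ≤ R := by exact_mod_cast (by omega : 1 ≤ R)
    have : (0 : ℝ) ≤ m * S := by positivity
    linarith
  have hsmall1 : ((R : ℝ) + m * S) * ε < 1 :=
    lt_of_le_of_lt (le_mul_of_one_le_left (by positivity) (one_le_pow₀ hB1)) hsmall
  have hrow : ∀ i, ∃ k : Fin m → ℤ, M' i = k ᵥ* M := by
    intro i
    apply hg
    set e : ℤ := ∑ j, M' i j * (z j - z' j) - residueVector W' i with he
    have hval : ∑ j, (M' i j : ℝ) * centre R W j + e =
        ∑ j, (M' i j : ℝ) * (centre R W j + z j - (centre R W' j + z' j)) := by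
      rw [he]
      push_cast
      rw [← centre_spec hR' W' i, ← hMdef', add_sub, ← Finset.sum_add_distrib,
        ← Finset.sum_sub_distrib]
      exact Finset.sum_congr rfl fun j _ => by ring
    by_contra hno
    have hne : ∑ j, (M' i j : ℝ) * centre R W j + e ≠ 0 := fun h =>
      hno ⟨-e, by push_cast; linarith⟩
    have h1 := one_le_abs_det_mul (centre_spec hR' W) (M' i) e hne (hM.det_ne_zero hR')
    rw [hval] at h1
    have h2 := abs_sum_mul_le (fun j => (M' i j : ℝ)) _ (hM'.sum_le i) hε hε0
    have h3 := hM.abs_det_le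
    have : |(M.det : ℝ)| * |∑ j, (M' i j : ℝ) * (centre R W j + z j - (centre R W' j + z' j))| ≤
        ((R : ℝ) + m * S) ^ m * (((R : ℝ) + m * S) * ε) :=
      mul_le_mul h3 h2 (abs_nonneg _) (by positivity)
    linarith
  have hMM : M' = M := by
    funext i
    obtain ⟨k, hk⟩ := hrow i
    have hk' : k - Pi.single i 1 = 0 := by
      refine hM.vecMul_eq_zero hR'.le _ fun j => ?_
      rw [Matrix.sub_vecMul, ← hk, Matrix.single_one_vecMul]
      obtain ⟨a1, a2⟩ := hM i j
      obtain ⟨b1, b2⟩ := hM' i j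
      have h1 : |M' i j - M i j| < S := by
        rw [abs_lt]
        constructor <;> linarith
      have h2 : ((m : ℤ) + 1) * S < R := by exact_mod_cast hR
      simp only [Pi.sub_apply, Matrix.row]
      linarith
    rw [hk, sub_eq_zero.1 hk', Matrix.single_one_vecMul]
    rfl
  have hc' : ∀ i, ∑ j, (M i j : ℝ) * centre R W' j = residueVector W' i := fun i => by
    rw [← hMM]; exact centre_spec hR' W' i
  have hx : ∀ i, centre R W i + z i - (centre R W' i + z' i) = 0 := by
    intro i
    have h := hM.dominance hR'.le (fun j => centre R W j + z j - (centre R W' j + z' j)) 0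
      (fun i => by
        set e : ℤ := residueVector W i - residueVector W' i + ∑ j, M i j * (z j - z' j) with he
        have hval : ∑ j, (M i j : ℝ) * (centre R W j + z j - (centre R W' j + z' j)) = e := by
          rw [he]
          push_cast
          rw [← centre_spec hR' W i, ← hc' i, ← Finset.sum_sub_distrib,
            ← Finset.sum_add_distrib]
          exact Finset.sum_congr rfl fun j _ => by ring
        have h2 := abs_sum_mul_le (fun j => (M i j : ℝ)) _ (hM.sum_le i) hε hε0
        rw [hval] at h2 ⊢
        have h3 : |(e : ℝ)| < 1 := lt_of_le_of_lt h2 hsmall1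
        have h4 : |e| < 1 := by exact_mod_cast h3
        rw [Int.abs_lt_one_iff.1 h4]; simp) i
    have h1 : (m : ℝ) * S < R := by exact_mod_cast hR'
    have h2 : |centre R W i + z i - (centre R W' i + z' i)| ≤ 0 := by
      by_contra hne
      push Not at hne
      nlinarith
    exact abs_nonpos_iff.1 h2
  have hcc : ∀ i, (residueVector W i - residueVector W' i : ℤ) = ∑ j, M i j * (z' j - z j) := by
    intro i
    have : ((residueVector W i - residueVector W' i : ℤ) : ℝ) =
        ((∑ j, M i j * (z' j - z j) : ℤ) : ℝ) := by
      push_cast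
      rw [← centre_spec hR' W i, ← hc' i, ← Finset.sum_sub_distrib]
      refine Finset.sum_congr rfl fun j _ => ?_
      have := hx j
      rw [← mul_sub]
      congr 1
      linarith
    exact_mod_cast this
  have hz : ∀ i, z' i - z i = 0 := by
    intro i
    have h := hM.dominance hR'.le (fun j => ((z' j - z j : ℤ) : ℝ)) S (fun i => by
      have h1 : ∑ j, (M i j : ℝ) * ((z' j - z j : ℤ) : ℝ) =
          ((residueVector W i - residueVector W' i : ℤ) : ℝ) := by
        rw [hcc i]; push_cast; rfl
      rw [h1]
      obtain ⟨a1, a2⟩ := residueVector_bounds W i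
      obtain ⟨b1, b2⟩ := residueVector_bounds W' i
      have : |residueVector W i - residueVector W' i| ≤ S := by
        rw [_root_.abs_le]; constructor <;> linarith
      exact_mod_cast this) i
    by_contra hne
    have h1 : (1 : ℝ) ≤ |((z' i - z i : ℤ) : ℝ)| := by exact_mod_cast Int.one_le_abs hne
    have h2 : ((m : ℝ) + 1) * S < R := by exact_mod_cast hR
    have h3 : (0 : ℝ) ≤ S := Nat.cast_nonneg S
    nlinarith
  refine ⟨residue_injective hMM.symm (funext fun i => ?_), funext fun i => ?_⟩
  · have := hcc i
    simp only [hz, mul_zero, Finset.sum_const_zero] at this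
    linarith
  · have := hz i
    linarith

lemma one_add_inv_pow_le (m : ℕ) : (1 + 1 / (m : ℝ)) ^ m ≤ 3 := by
  rcases Nat.eq_zero_or_pos m with rfl | hm
  · norm_num
  have hm' : (m : ℝ) ≠ 0 := by exact_mod_cast hm.ne'
  have h1 : 1 + 1 / (m : ℝ) ≤ Real.exp (1 / m) := by
    linarith [Real.add_one_le_exp (1 / (m : ℝ))]
  calc (1 + 1 / (m : ℝ)) ^ m ≤ Real.exp (1 / m) ^ m := pow_le_pow_left₀ (by positivity) h1 m
    _ = Real.exp 1 := by rw [← Real.exp_nat_mul, mul_one_div_cancel hm']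
    _ ≤ 3 := Real.exp_one_lt_d9.le.trans (by norm_num)

set_option maxHeartbeats 1000000 in
open MeasureTheory in
open Classical in
/-- A set of measure bounded below on which a dilated linear form takes no small values at
integer vectors of norm less than `t`. -/
lemma exists_isOpen_no_small_values {m : ℕ} (hm : 1 ≤ m) :
    ∃ δ : ℝ, 0 < δ ∧ ∃ T : ℕ, ∀ t : ℕ, T ≤ t → ∀ q : ℕ, 0 < q →
      ∃ U : Set (Fin m → ℝ), IsOpen U ∧ U ⊆ Metric.ball 0 3 ∧ ENNReal.ofReal δ ≤ volume U ∧
        ∀ η ∈ U, ∀ b : Fin m → ℤ, b ≠ 0 → (∀ i, |b i| < t) → ∀ z : ℤ,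
          1 / 4 / (t : ℝ) ^ m ≤ |∑ i, (b i : ℝ) * (q * η i) + z| := by
  set ℓ : ℕ := 4 * m * m with hℓ
  set L : ℕ := ℓ + m with hL
  set Y : ℕ := 24 * (3 * (L + m)) ^ (m * (m + 1)) with hY
  set P : ℕ := Y.factorial with hP
  have hPpos : 0 < P := Nat.factorial_pos _
  have hm1 : (1 : ℝ) ≤ m := by exact_mod_cast hm
  have hm0 : (0 : ℝ) < m := by linarith
  have hℓpos : 0 < ℓ := by positivity
  have hℓ0 : (0 : ℝ) < ℓ := by exact_mod_cast hℓpos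
  have hℓr : (ℓ : ℝ) = 4 * m * m := by rw [hℓ]; push_cast; ring
  refine ⟨1 / 24 * (1 / (ℓ : ℝ)) ^ (m * (m + 1)) * (1 / (12 * m)) ^ m, by positivity,
    P * ℓ * (4 * m), fun t ht q hq => ?_⟩
  have ht0 : 0 < t := lt_of_lt_of_le (by positivity) ht
  have ht0' : (0 : ℝ) < t := by exact_mod_cast ht0
  have hq0 : (0 : ℝ) < q := by exact_mod_cast hq
  set S : ℕ := P * (t / (P * ℓ) + 1) with hS
  have hSpos : 0 < S := by positivity
  have : NeZero S := ⟨hSpos.ne'⟩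
  set R : ℕ := L * S with hRdef
  have hSt : t < ℓ * S := by
    have h1 := Nat.lt_mul_div_succ t (by positivity : 0 < P * ℓ)
    calc t < P * ℓ * (t / (P * ℓ) + 1) := h1
      _ = ℓ * S := by rw [hS]; ring
  have hSt' : ℓ * S ≤ t + P * ℓ := by
    have h1 := Nat.mul_div_le t (P * ℓ)
    calc ℓ * S = P * ℓ * (t / (P * ℓ)) + P * ℓ := by rw [hS]; ring
      _ ≤ _ := by omega
  have hRS : R = ℓ * S + m * S := by rw [hRdef, hL]; ring
  have hℓ1 : 1 < ℓ := by rw [hℓ]; nlinarith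
  have hRm : (m + 1) * S < R := by
    rw [hRS]; nlinarith
  have hRm' : m * S < R := by nlinarith
  set B : ℝ := (R : ℝ) + m * S with hB
  have hBt : B ≤ t * (1 + 1 / m) := by
    have h1 : (ℓ : ℝ) * S ≤ t + P * ℓ := by exact_mod_cast hSt'
    have h2 : (P : ℝ) * ℓ * (4 * m) ≤ t := by exact_mod_cast ht
    have h3 : B = ℓ * S * (1 + 1 / (2 * m)) := by
      rw [hB, hRS, hℓr]; push_cast; rw [hℓr]; field_simp; ring
    have h4 : (P : ℝ) * ℓ ≤ t / (4 * m) := by rw [le_div_iff₀ (by positivity)]; exact h2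
    have h5 : (ℓ : ℝ) * S ≤ t * (1 + 1 / (4 * m)) := by
      calc (ℓ : ℝ) * S ≤ t + t / (4 * m) := by linarith
        _ = _ := by ring
    rw [h3]
    calc (ℓ : ℝ) * S * (1 + 1 / (2 * m)) ≤ t * (1 + 1 / (4 * m)) * (1 + 1 / (2 * m)) :=
          mul_le_mul_of_nonneg_right h5 (by positivity)
      _ = t * ((1 + 1 / (4 * m)) * (1 + 1 / (2 * m))) := by ring
      _ ≤ _ := by
        refine mul_le_mul_of_nonneg_left ?_ ht0'.le
        have hi : (1 : ℝ) / m ≤ 1 := by rw [div_le_one hm0]; exact hm1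
        have hi0 : (0 : ℝ) < 1 / m := by positivity
        have e1 : (1 : ℝ) / (4 * m) = 1 / m / 4 := by field_simp
        have e2 : (1 : ℝ) / (2 * m) = 1 / m / 2 := by field_simp
        rw [e1, e2]
        nlinarith
  have hB0 : 0 < B := by positivity
  have hBm : B ^ m ≤ 3 * (t : ℝ) ^ m := by
    calc B ^ m ≤ (t * (1 + 1 / m)) ^ m := pow_le_pow_left₀ hB0.le hBt m
      _ = t ^ m * (1 + 1 / (m : ℝ)) ^ m := mul_pow _ _ _
      _ ≤ t ^ m * 3 := mul_le_mul_of_nonneg_left (one_add_inv_pow_le m) (by positivity)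
      _ = _ := by ring
  have hB2 : B ≤ 2 * t := by
    have hi : (1 : ℝ) / m ≤ 1 := by rw [div_le_one hm0]; exact hm1
    nlinarith
  set ρ : ℝ := 1 / (24 * m * t ^ (m + 1)) with hρ
  have hρ0 : 0 < ρ := by positivity
  have hsmall : B ^ m * (B * (2 * ρ)) < 1 := by
    calc B ^ m * (B * (2 * ρ)) ≤ 3 * (t : ℝ) ^ m * (2 * t * (2 * ρ)) := by gcongr
      _ = 1 / (2 * m) := by rw [hρ]; field_simp; ring
      _ < 1 := by rw [div_lt_one (by positivity)]; linarith
  set good := Finset.univ.filter fun W : Fin m → Option (Fin m) → ZMod S =>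
      GoodCentre (residueMatrix R W) (centre R W) with hgood
  let pt : (Fin m → Option (Fin m) → ZMod S) × (Fin m → Fin q) → Fin m → ℝ := fun w i =>
    (centre R w.1 i + (((w.2 i : ℕ) : ℤ) : ℝ)) / q
  set I := good ×ˢ (Finset.univ : Finset (Fin m → Fin q)) with hI
  have hdist : ∀ w η, η ∈ Metric.ball (pt w) (ρ / q) →
      ∀ i, |q * η i - (centre R w.1 i + (((w.2 i : ℕ) : ℤ) : ℝ))| < ρ := by
    intro w η hη i
    have h1 : |η i - pt w i| < ρ / q := by
      have := lt_of_le_of_lt (dist_le_pi_dist η (pt w) i) (Metric.mem_ball.1 hη)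
      rwa [Real.dist_eq] at this
    have h2 : q * η i - (centre R w.1 i + (((w.2 i : ℕ) : ℤ) : ℝ)) = q * (η i - pt w i) := by
      simp only [pt]; field_simp
    rw [h2, abs_mul, Nat.abs_cast]
    rwa [lt_div_iff₀ hq0, mul_comm] at h1
  refine ⟨⋃ w ∈ I, Metric.ball (pt w) (ρ / q), isOpen_biUnion fun _ _ => Metric.isOpen_ball,
    ?_, ?_, ?_⟩
  · refine Set.iUnion₂_subset fun w _ => fun η hη => ?_
    rw [Metric.mem_ball, dist_zero_right, pi_norm_lt_iff (by norm_num)]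
    intro i
    have h1 := hdist w η hη i
    have h2 := abs_centre_le hRm.le w.1 i
    have hρ1 : ρ ≤ 1 := by
      rw [hρ, div_le_one (by positivity)]
      have : (1 : ℝ) ≤ (t : ℝ) ^ (m + 1) := one_le_pow₀ (by exact_mod_cast ht0)
      nlinarith
    have h3 : ((w.2 i : ℕ) : ℝ) + 1 ≤ q := by exact_mod_cast (w.2 i).isLt
    have h4 : (0 : ℝ) ≤ ((w.2 i : ℕ) : ℝ) := Nat.cast_nonneg _
    have hq1 : (1 : ℝ) ≤ q := by exact_mod_cast hq
    rw [Real.norm_eq_abs, ← mul_lt_mul_iff_right₀ hq0, ← Nat.abs_cast q, ← abs_mul, Nat.abs_cast]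
    rw [abs_lt] at h1 ⊢
    rw [_root_.abs_le] at h2
    push_cast at h1
    constructor <;> linarith [h1.1, h1.2, h2.1, h2.2]
  · have hdisj : Set.PairwiseDisjoint (↑I) fun w => Metric.ball (pt w) (ρ / q) := by
      intro w hw w' _ hne
      have hwg := (Finset.mem_filter.1 (Finset.mem_product.1 (Finset.mem_coe.1 hw)).1).2
      rw [Function.onFun, Set.disjoint_left]
      intro η hη hη'
      apply hne
      have hsep := centre_separated (z := fun i => ((w.2 i : ℕ) : ℤ))
        (z' := fun i => ((w'.2 i : ℕ) : ℤ)) (W' := w'.1) hRm hwg (ε := 2 * ρ) (by positivity)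
        (fun i => by
          have h1 := hdist w η hη i
          have h2 := hdist w' η hη' i
          rw [abs_lt] at h1 h2
          rw [_root_.abs_le]
          constructor <;> linarith [h1.1, h1.2, h2.1, h2.2]) hsmall
      refine Prod.ext hsep.1 (funext fun i => Fin.ext ?_)
      have := congrFun hsep.2 i
      simpa using this
    rw [measure_biUnion_finset hdisj fun _ _ => measurableSet_ball]
    simp_rw [Real.volume_pi_ball _ (div_pos hρ0 hq0)]
    rw [Finset.sum_const, hI, Finset.card_product, Finset.card_univ, nsmul_eq_mul,
      ← ENNReal.ofReal_natCast, ← ENNReal.ofReal_mul (Nat.cast_nonneg _)]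
    apply ENNReal.ofReal_le_ofReal
    simp only [Fintype.card_fun, Fintype.card_fin]
    have h1 : S ^ (m * (m + 1)) ≤ 24 * good.card :=
      card_goodCentre_ge (by omega) hY (Dvd.intro _ rfl)
    have h2 : (S : ℝ) ^ (m * (m + 1)) ≤ 24 * good.card := by exact_mod_cast h1
    have h3 : (t : ℝ) / ℓ ≤ S := by
      rw [div_le_iff₀ hℓ0, mul_comm]
      exact_mod_cast hSt.le
    have h4 : ((t : ℝ) / ℓ) ^ (m * (m + 1)) ≤ 24 * good.card :=
      (pow_le_pow_left₀ (by positivity) h3 _).trans h2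
    have h5 : ((good.card * q ^ m : ℕ) : ℝ) * (2 * (ρ / q)) ^ m = good.card * (2 * ρ) ^ m := by
      push_cast
      rw [mul_assoc, ← mul_pow]
      congr 2
      field_simp
    rw [h5]
    have h6 : 1 / 24 * (1 / (ℓ : ℝ)) ^ (m * (m + 1)) * (1 / (12 * m)) ^ m =
        1 / 24 * ((t : ℝ) / ℓ) ^ (m * (m + 1)) * (2 * ρ) ^ m := by
      have e1 : 2 * ρ = 1 / (12 * m) * (1 / t ^ (m + 1)) := by rw [hρ]; field_simp; norm_num
      rw [e1, mul_pow (1 / (12 * (m : ℝ))), div_eq_mul_one_div (t : ℝ) ℓ, mul_pow (t : ℝ),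
        div_pow 1 ((t : ℝ) ^ (m + 1)), ← pow_mul, mul_comm (m + 1) m]
      field_simp
      rw [one_pow]
    rw [h6]
    exact mul_le_mul_of_nonneg_right (by linarith) (by positivity)
  · intro η hη b hb hbt z
    obtain ⟨w, hw, hηw⟩ := Set.mem_iUnion₂.1 hη
    have hwg := (Finset.mem_filter.1 (Finset.mem_product.1 hw).1).2
    have hd := hdist w η hηw
    have h1 := hwg.one_le (residueMatrix_nearDiag R w.1) (centre_spec hRm' w.1) hRm' b hb
      (fun i => by
        have e1 := hbt i
        have e2 : (t : ℤ) < ℓ * S := by exact_mod_cast hSt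
        have e3 : (R : ℤ) = ℓ * S + m * S := by exact_mod_cast hRS
        linarith) (z + ∑ i, b i * ((w.2 i : ℕ) : ℤ))
    have h2 : |((residueMatrix R w.1).det : ℝ)| ≤ 3 * (t : ℝ) ^ m :=
      (residueMatrix_nearDiag R w.1).abs_det_le.trans hBm
    set V : ℝ := ∑ i, (b i : ℝ) * centre R w.1 i + ((z + ∑ i, b i * ((w.2 i : ℕ) : ℤ) : ℤ) : ℝ)
      with hV
    have h3 : 1 / (3 * (t : ℝ) ^ m) ≤ |V| := by
      rw [div_le_iff₀ (by positivity), mul_comm]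
      exact h1.trans (mul_le_mul_of_nonneg_right h2 (abs_nonneg _))
    have h4 : ∑ i, (b i : ℝ) * (q * η i) + z =
        V + ∑ i, (b i : ℝ) * (q * η i - (centre R w.1 i + (((w.2 i : ℕ) : ℤ) : ℝ))) := by
      rw [hV]
      push_cast
      rw [show ∀ x y w v : ℝ, x + (y + w) + v = x + w + v + y by intros; ring,
        ← Finset.sum_add_distrib, ← Finset.sum_add_distrib]
      congr 1
      exact Finset.sum_congr rfl fun i _ => by ring
    have h5 : |∑ i, (b i : ℝ) * (q * η i - (centre R w.1 i + (((w.2 i : ℕ) : ℤ) : ℝ)))| ≤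
        (m * t) * ρ := by
      refine abs_sum_mul_le _ _ ?_ (fun i => (hd i).le) hρ0.le
      calc ∑ i, |(b i : ℝ)| ≤ ∑ _i : Fin m, (t : ℝ) := Finset.sum_le_sum fun i _ => by
            exact_mod_cast (hbt i).le
        _ = _ := by simp
    have h6 : (m * t) * ρ = 1 / 24 / (t : ℝ) ^ m := by rw [hρ]; field_simp; ring
    have h7 : 1 / (3 * (t : ℝ) ^ m) = 1 / 3 / (t : ℝ) ^ m := by field_simp
    have h8 : (1 : ℝ) / 3 / (t : ℝ) ^ m - 1 / 24 / (t : ℝ) ^ m - 1 / 4 / (t : ℝ) ^ m =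
        1 / 24 / (t : ℝ) ^ m := by ring
    have h9 : (0 : ℝ) < 1 / 24 / (t : ℝ) ^ m := by positivity
    rw [h4]
    have h10 := abs_sub_abs_le_abs_sub V
      (-∑ i, (b i : ℝ) * (q * η i - (centre R w.1 i + (((w.2 i : ℕ) : ℤ) : ℝ))))
    rw [abs_neg, sub_neg_eq_add] at h10
    linarith

end

/-- A rapidly growing sequence of integers, alternately powers of `2` and of `3`. -/
lemma exists_scales (n : ℕ) : ∃ X : ℕ → ℕ, (∀ k, 2 ≤ X k) ∧ (∀ k, X k ^ 2 ≤ X (k + 1)) ∧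
    (∀ k, X (k + 1) ^ (n + 1) * X k ≤ X (k + 2)) ∧ (∀ k, (X k).Coprime (X (k + 1))) ∧
    ∀ k, ∃ μ : ℕ, X (k + 2) = X k * μ ∧
      ∀ p a : ℤ, IsCoprime (p * μ + (6 * a + 1)) (X (k + 2) : ℤ) := by
  set K : ℕ := 2 * n + 4 with hK
  let g : ℕ → ℕ := fun k => if Even k then 2 else 3
  have hg2 : ∀ k, 2 ≤ g k := fun k => by simp only [g]; split_ifs <;> norm_num
  have hg3 : ∀ k, g k ≤ 3 := fun k => by simp only [g]; split_ifs <;> norm_num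
  have hgg : ∀ k, g (k + 2) = g k := fun k => by
    simp only [g, Nat.even_add, even_two, iff_true]
  have hg6 : ∀ k, g k ∣ 6 := fun k => by simp only [g]; split_ifs <;> norm_num
  have hlow : ∀ k, 2 ^ K ^ k ≤ g k ^ K ^ k := fun k => Nat.pow_le_pow_left (hg2 k) _
  have hupp : ∀ k, g k ^ K ^ k ≤ 2 ^ (2 * K ^ k) := fun k => by
    rw [pow_mul]; exact Nat.pow_le_pow_left ((hg3 k).trans (by norm_num)) _
  have hKpos : 0 < K := by omega
  refine ⟨fun k => g k ^ K ^ k, fun k => ?_, fun k => ?_, fun k => ?_, fun k => ?_, fun k => ?_⟩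
  · calc 2 = 2 ^ 1 := rfl
      _ ≤ 2 ^ K ^ k := Nat.pow_le_pow_right (by norm_num) (Nat.one_le_pow _ _ hKpos)
      _ ≤ _ := hlow k
  · calc (g k ^ K ^ k) ^ 2 ≤ (2 ^ (2 * K ^ k)) ^ 2 := Nat.pow_le_pow_left (hupp k) 2
      _ = 2 ^ (K ^ k * 4) := by rw [← pow_mul]; ring_nf
      _ ≤ 2 ^ K ^ (k + 1) := by
        rw [pow_succ]
        exact Nat.pow_le_pow_right (by norm_num) (Nat.mul_le_mul_left _ (by omega))
      _ ≤ _ := hlow (k + 1)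
  · calc (g (k + 1) ^ K ^ (k + 1)) ^ (n + 1) * g k ^ K ^ k
        ≤ (2 ^ (2 * K ^ (k + 1))) ^ (n + 1) * 2 ^ (2 * K ^ k) :=
          Nat.mul_le_mul (Nat.pow_le_pow_left (hupp _) _) (hupp k)
      _ ≤ (2 ^ (2 * K ^ (k + 1))) ^ (n + 1) * 2 ^ (2 * K ^ (k + 1)) := by
          gcongr <;> omega
      _ = 2 ^ K ^ (k + 2) := by
          rw [← pow_mul, ← pow_add]
          congr 1
          rw [pow_succ K (k + 1), hK]; ring
      _ ≤ _ := hlow (k + 2)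
  · apply Nat.Coprime.pow
    rcases Nat.even_or_odd k with h | h
    · simp [g, h, Nat.even_add_one]; decide
    · simp [g, Nat.not_even_iff_odd.2 h, Nat.even_add_one]; decide
  · have hlt : K ^ k < K ^ (k + 2) := Nat.pow_lt_pow_right (by omega) (by omega)
    refine ⟨g k ^ (K ^ (k + 2) - K ^ k), ?_, fun p a => ?_⟩
    · change g (k + 2) ^ _ = _
      rw [hgg, ← pow_add]
      congr 1; omega
    · change IsCoprime _ ((g (k + 2) ^ K ^ (k + 2) : ℕ) : ℤ)
      rw [hgg, Nat.cast_pow, Nat.cast_pow]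
      apply IsCoprime.pow_right
      obtain ⟨u, hu⟩ := hg6 k
      obtain ⟨e, he⟩ : ∃ e, K ^ (k + 2) - K ^ k = e + 1 := ⟨K ^ (k + 2) - K ^ k - 1, by omega⟩
      have hu' : (6 : ℤ) = g k * u := by exact_mod_cast hu
      refine ⟨1, -(p * (g k : ℤ) ^ e + u * a), ?_⟩
      rw [he, hu']; ring

/-- Two real numbers with alternating rational approximations of prescribed precision. -/
lemma exists_alternating_approximations {n : ℕ} (hn : 1 ≤ n) {c : ℝ} (hc : 0 < c) (hc1 : c ≤ 1) :
    ∃ (X : ℕ → ℕ) (p : ℕ → ℤ) (δ : ℕ → ℝ), (∀ k, 2 ≤ X k) ∧ (∀ k, X k ^ 2 ≤ X (k + 1)) ∧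
      (∀ k, (X k).Coprime (X (k + 1))) ∧ (∀ k, 0 < δ k) ∧
      (∀ k, |(X k : ℝ) * X (k + 1) ^ n * δ k - c| ≤ 6 / X (k + 1)) ∧
      (∀ k, δ (k % 2) = p k / X k + δ k) ∧ ∀ k, IsCoprime (p (k + 2)) (X (k + 2) : ℤ) := by
  obtain ⟨X, hX2, hXsq, hXn, hXc, hXμ⟩ := exists_scales n
  choose μ hμ hcop using hXμ
  have hXpos : ∀ k, (0 : ℝ) < X k := fun k => by exact_mod_cast (by have := hX2 k; omega : 0 < X k)
  have hX2' : ∀ k, (2 : ℝ) ≤ X k := fun k => by exact_mod_cast hX2 k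
  have hXsq' : ∀ k, (X k : ℝ) ^ 2 ≤ X (k + 1) := fun k => by exact_mod_cast hXsq k
  have hXn' : ∀ k, (X (k + 1) : ℝ) ^ (n + 1) * X k ≤ X (k + 2) := fun k => by exact_mod_cast hXn k
  have hμ' : ∀ k, (X (k + 2) : ℝ) = X k * μ k := fun k => by exact_mod_cast hμ k
  have hμpos : ∀ k, (0 : ℝ) < μ k := fun k => by
    have := hXpos (k + 2)
    rw [hμ'] at this
    exact (mul_pos_iff_of_pos_left (hXpos k)).1 this
  have hμn : ∀ k, (X (k + 1) : ℝ) ^ (n + 1) ≤ μ k := fun k => by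
    have := hXn' k
    rw [hμ', mul_comm] at this
    exact le_of_mul_le_mul_left this (hXpos k)
  let f : ℕ → ℕ := fun k => ⌊c * μ k / (6 * X (k + 1) ^ n)⌋₊
  let a : ℕ → ℤ := fun k => 6 * (f k : ℤ) + 1
  let d : ℕ → ℝ := fun k => a k / X (k + 2)
  have ha : ∀ k, |(a k : ℝ) - c * μ k / X (k + 1) ^ n| ≤ 5 ∧
      (a k : ℝ) ≤ c * μ k / X (k + 1) ^ n + 1 := by
    intro k
    have hx := hXpos (k + 1)
    have hm := hμpos k
    have h1 : (f k : ℝ) ≤ c * μ k / (6 * X (k + 1) ^ n) := Nat.floor_le (by positivity)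
    have h2 : c * μ k / (6 * X (k + 1) ^ n) < f k + 1 := Nat.lt_floor_add_one _
    have h3 : c * μ k / (6 * X (k + 1) ^ n) = c * μ k / X (k + 1) ^ n / 6 := by field_simp
    rw [h3] at h1 h2
    have h4 : (a k : ℝ) = 6 * f k + 1 := by simp only [a]; push_cast; ring
    rw [h4, _root_.abs_le]
    refine ⟨⟨by linarith, by linarith⟩, by linarith⟩
  have hapos : ∀ k, (0 : ℝ) < a k := fun k => by
    have : 0 < a k := by simp only [a]; positivity
    exact_mod_cast this
  have hdpos : ∀ k, 0 < d k := fun k => div_pos (hapos k) (hXpos _)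
  have hdc : ∀ k, |(X k : ℝ) * X (k + 1) ^ n * d k - c| ≤ 5 / X (k + 1) := by
    intro k
    have hx := hXpos (k + 1)
    have hx0 := hXpos k
    have hm := hμpos k
    have e : (X k : ℝ) * X (k + 1) ^ n * d k - c =
        (a k - c * μ k / X (k + 1) ^ n) * (X (k + 1) ^ n / μ k) := by
      simp only [d]; rw [hμ']; field_simp
    rw [e, abs_mul, abs_of_pos (div_pos (pow_pos hx n) hm)]
    calc _ ≤ 5 * ((X (k + 1) : ℝ) ^ n / μ k) := by
          gcongr; exact (ha k).1
      _ ≤ 5 * (1 / X (k + 1)) := by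
          refine mul_le_mul_of_nonneg_left ?_ (by norm_num)
          rw [div_le_div_iff₀ hm hx, one_mul, ← pow_succ]
          exact hμn k
      _ = _ := by ring
  have hd2 : ∀ k, d k ≤ 2 / X (k + 1) := by
    intro k
    have hx := hXpos (k + 1)
    have hx0 := hXpos k
    have h1 := (_root_.abs_le.1 (hdc k)).2
    have h2 : (X (k + 1) : ℝ) * d k ≤ X k * X (k + 1) ^ n * d k / 2 := by
      have h3 : (X (k + 1) : ℝ) ≤ X (k + 1) ^ n := le_self_pow₀ (by linarith [hX2' (k + 1)]) (by omega)
      have h4 : (2 : ℝ) * X (k + 1) ≤ X k * X (k + 1) ^ n :=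
        mul_le_mul (hX2' k) h3 hx.le hx0.le
      nlinarith [hdpos k]
    have h5 : (5 : ℝ) / X (k + 1) ≤ 5 / 2 := by gcongr; exact hX2' _
    rw [le_div_iff₀ hx]
    linarith
  have hXmono : ∀ k i, (X k : ℝ) * 2 ^ i ≤ X (k + 2 * i) := by
    intro k i
    induction i with
    | zero => simp
    | succ i ih =>
      have h1 := hXsq' (k + 2 * i)
      have h2 := hXsq' (k + 2 * i + 1)
      have h3 := hX2' (k + 2 * i)
      have h4 := hX2' (k + 2 * i + 1)
      rw [show k + 2 * (i + 1) = k + 2 * i + 1 + 1 by ring, pow_succ]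
      nlinarith
  have hdgeo : ∀ k i, d (k + 2 * i) ≤ 2 / X (k + 1) * (1 / 2) ^ i := by
    intro k i
    have h1 := hd2 (k + 2 * i)
    have h2 := hXmono (k + 1) i
    have hx := hXpos (k + 1)
    calc d (k + 2 * i) ≤ 2 / X (k + 2 * i + 1) := h1
      _ ≤ 2 / (X (k + 1) * 2 ^ i) := by
        gcongr
        rwa [show k + 2 * i + 1 = k + 1 + 2 * i by ring]
      _ = _ := by rw [_root_.one_div_pow]; field_simp
  have hgeo : ∀ k, Summable fun i : ℕ => 2 / (X (k + 1) : ℝ) * (1 / 2) ^ i := fun k =>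
    summable_geometric_two.mul_left _
  have hsum : ∀ k, Summable fun i => d (k + 2 * i) := fun k =>
    Summable.of_nonneg_of_le (fun i => (hdpos _).le) (hdgeo k) (hgeo k)
  let δ : ℕ → ℝ := fun k => ∑' i, d (k + 2 * i)
  have hδpos : ∀ k, 0 < δ k := fun k => (hsum k).tsum_pos (fun i => (hdpos _).le) 0 (hdpos _)
  have hδle : ∀ k, δ k ≤ 4 / X (k + 1) := by
    intro k
    calc δ k ≤ ∑' i : ℕ, 2 / (X (k + 1) : ℝ) * (1 / 2) ^ i := (hsum k).tsum_le_tsum (hdgeo k) (hgeo k)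
      _ = _ := by rw [tsum_mul_left, tsum_geometric_two]; ring
  have hδrec : ∀ k, δ k = d k + δ (k + 2) := by
    intro k
    change ∑' i, d (k + 2 * i) = d k + ∑' i, d (k + 2 + 2 * i)
    rw [(hsum k).tsum_eq_zero_add]
    congr 1
    exact tsum_congr fun i => by congr 1; ring
  let P : ℕ → ℤ × ℤ := fun k => Nat.rec (0, 0) (fun k z => (z.2, z.1 * μ k + a k)) k
  have hP : ∀ k, (P (k + 2)).1 = (P k).1 * μ k + a k := fun k => rfl
  refine ⟨X, fun k => (P k).1, δ, hX2, hXsq, hXc, hδpos, fun k => ?_, fun k => ?_, fun k => ?_⟩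
  · have hx := hXpos (k + 1)
    have hx0 := hXpos k
    have hx2 := hXpos (k + 2)
    have hx3 := hXpos (k + 3)
    have h1 : (X k : ℝ) * X (k + 1) ^ n * δ (k + 2) ≤ 1 / X (k + 1) := by
      have e1 := hδle (k + 2)
      have e2 := hXsq' (k + 2)
      have e3 := hXn' k
      have e4 : (4 : ℝ) ≤ X (k + 2) := by
        have := hXsq' (k + 1)
        have := hX2' (k + 1)
        nlinarith
      calc (X k : ℝ) * X (k + 1) ^ n * δ (k + 2) ≤ X k * X (k + 1) ^ n * (4 / X (k + 3)) := by
            gcongr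
        _ ≤ 1 / X (k + 1) := by
            rw [← mul_div_assoc, div_le_div_iff₀ hx3 hx]
            have : (X k : ℝ) * X (k + 1) ^ n * X (k + 1) ≤ X (k + 2) := by
              calc _ = (X (k + 1) : ℝ) ^ (n + 1) * X k := by ring
                _ ≤ _ := e3
            have e2' : (X (k + 2) : ℝ) ^ 2 ≤ X (k + 3) := e2
            nlinarith
    have h2 : (0 : ℝ) < X k * X (k + 1) ^ n * δ (k + 2) := by
      have := hδpos (k + 2); positivity
    have h3 := hdc k
    rw [_root_.abs_le] at h3 ⊢
    have h4 : (6 : ℝ) / X (k + 1) = 5 / X (k + 1) + 1 / X (k + 1) := by ring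
    have h5 : (0 : ℝ) < 1 / X (k + 1) := by positivity
    rw [hδrec, mul_add, h4]
    constructor <;> linarith [h3.1, h3.2]
  · induction k using Nat.twoStepInduction with
    | zero => simp [P]
    | one => simp [P]
    | more k ih _ =>
      rw [show (k + 2) % 2 = k % 2 by omega, ih, hδrec k]
      simp only [hP]
      rw [hμ']
      have hx := hXpos k
      have hm := hμpos k
      have : d k = a k / (X k * μ k) := by simp only [d]; rw [hμ']
      rw [this]
      push_cast
      field_simp
      ring
  · change IsCoprime (P (k + 2)).1 _
    rw [hP]
    exact hcop k _ _

lemma psiDual_le {n : ℕ} {ξ : Fin n → ℝ} {t : ℝ} (b : Fin n → ℤ) (z : ℤ) (hb : b ≠ 0)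
    (ht : ∀ i, |(b i : ℝ)| ≤ t) : psiDual n ξ t ≤ |(∑ i, (b i : ℝ) * ξ i) + z| := by
  refine csInf_le ⟨0, ?_⟩ ⟨b, z, Function.ne_iff.1 hb, ht, rfl⟩
  rintro r ⟨_, _, _, _, rfl⟩
  exact abs_nonneg _

lemma psiDual_nonneg (n : ℕ) (ξ : Fin n → ℝ) (t : ℝ) : 0 ≤ psiDual n ξ t := by
  refine Real.sInf_nonneg ?_
  rintro r ⟨_, _, _, _, rfl⟩
  exact abs_nonneg _

lemma le_psiDual {n : ℕ} (hn : 0 < n) {ξ : Fin n → ℝ} {t r : ℝ} (ht : 1 ≤ t)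
    (h : ∀ b : Fin n → ℤ, b ≠ 0 → (∀ i, |(b i : ℝ)| ≤ t) → ∀ z : ℤ,
      r ≤ |(∑ i, (b i : ℝ) * ξ i) + z|) : r ≤ psiDual n ξ t := by
  refine le_csInf ⟨_, fun _ => 1, 0, ⟨⟨0, hn⟩, one_ne_zero⟩, fun i => by simpa using ht, rfl⟩ ?_
  rintro _ ⟨b, z, hb, hbt, rfl⟩
  exact h b (Function.ne_iff.2 hb) hbt z

/-- If the first two coordinates have very good rational approximations with coprime
denominators `A` and `B`, then the smallest linear form of height below `B` is `A * d`. -/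
lemma mul_le_abs_linear_form {m A B : ℕ} {u v : ℤ} {x y d d' : ℝ} {η : Fin m → ℝ}
    (hA : 0 < A) (hB : 0 < B) (hAB : A.Coprime B) (hu : IsCoprime u (A : ℤ))
    (hv : IsCoprime v (B : ℤ)) (hx : x = u / A + d) (hy : y = v / B + d') (hd : 0 < d)
    (hd' : 0 < d')
    (hη : ∀ b : Fin m → ℤ, b ≠ 0 → (∀ i, |b i| < B) → ∀ z : ℤ,
      1 / 4 / (B : ℝ) ^ m ≤ |∑ i, (b i : ℝ) * (((A * B : ℕ) : ℝ) * η i) + z|)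
    (hsmall : (A * B : ℝ) * (A * d + B * d + B * d') ≤ 1 / 4 / (B : ℝ) ^ m)
    {b₀ b₁ : ℤ} {b : Fin m → ℤ} (hb : ¬ (b₀ = 0 ∧ b₁ = 0 ∧ b = 0)) (hb₀ : |b₀| < B)
    (hb₁ : |b₁| < B) (hbB : ∀ i, |b i| < B) (z : ℤ) :
    (A : ℝ) * d ≤ |b₀ * x + (b₁ * y + ∑ i, (b i : ℝ) * η i) + z| := by
  have hA' : (0 : ℝ) < A := by exact_mod_cast hA
  have hB' : (0 : ℝ) < B := by exact_mod_cast hB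
  set N : ℤ := b₀ * u * B + b₁ * v * A + z * (A * B) with hN
  set S : ℝ := ∑ i, (b i : ℝ) * (((A * B : ℕ) : ℝ) * η i) with hS
  have hS' : S = A * B * ∑ i, (b i : ℝ) * η i := by
    rw [hS, Finset.mul_sum]
    refine Finset.sum_congr rfl fun i _ => ?_
    push_cast; ring
  set E : ℝ := A * B * (b₀ * d + b₁ * d') with hE
  have key : (A * B : ℝ) * (b₀ * x + (b₁ * y + ∑ i, (b i : ℝ) * η i) + z) = S + N + E := by
    rw [hS', hN, hE, hx, hy]
    push_cast
    field_simp
    ring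
  have hb₀' : |(b₀ : ℝ)| ≤ B := by exact_mod_cast hb₀.le
  have hb₁' : |(b₁ : ℝ)| ≤ B := by exact_mod_cast hb₁.le
  have hEle : |E| ≤ A * B * (B * d + B * d') := by
    rw [hE, abs_mul, abs_of_pos (by positivity : (0 : ℝ) < A * B)]
    refine mul_le_mul_of_nonneg_left ((abs_add_le _ _).trans ?_) (by positivity)
    rw [abs_mul, abs_mul, abs_of_pos hd, abs_of_pos hd']
    gcongr
  have main : 1 / 4 / (B : ℝ) ^ m ≤ |S + N| →
      (A : ℝ) * d ≤ |b₀ * x + (b₁ * y + ∑ i, (b i : ℝ) * η i) + z| := by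
    intro h
    have h1 : |S + N| - |E| ≤ |S + N + E| := by
      have := abs_sub_abs_le_abs_sub (S + N) (-E)
      simpa using this
    have h2 : (A * B : ℝ) * (A * d) ≤
        (A * B : ℝ) * |b₀ * x + (b₁ * y + ∑ i, (b i : ℝ) * η i) + z| := by
      rw [← abs_of_pos (by positivity : (0 : ℝ) < A * B), ← abs_mul,
        abs_of_pos (by positivity : (0 : ℝ) < A * B), key]
      linarith
    exact le_of_mul_le_mul_left h2 (by positivity)
  by_cases hb0 : b = 0
  · have hS0 : S = 0 := by simp [hS, hb0]
    by_cases hN0 : N = 0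
    · have hBb₁ : (B : ℤ) ∣ b₁ := by
        have h1 : (B : ℤ) ∣ b₁ * v * A := ⟨-(b₀ * u + z * A), by linear_combination hN0⟩
        have h2 : IsCoprime (B : ℤ) A := (Nat.isCoprime_iff_coprime.2 hAB).symm
        exact hv.symm.dvd_of_dvd_mul_right (h2.dvd_of_dvd_mul_right h1)
      have hb₁0 : b₁ = 0 := Int.eq_zero_of_abs_lt_dvd hBb₁ hb₁
      have hBZ : (B : ℤ) ≠ 0 := by exact_mod_cast hB.ne'
      have hz : b₀ * u + z * A = 0 := by
        apply mul_right_cancel₀ hBZ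
        linear_combination hN0 - hN - v * A * hb₁0
      have hAb₀ : (A : ℤ) ∣ b₀ :=
        hu.symm.dvd_of_dvd_mul_right (⟨-z, by linear_combination hz⟩)
      have hb₀0 : b₀ ≠ 0 := fun h => hb ⟨h, hb₁0, hb0⟩
      have hAle : (A : ℤ) ≤ |b₀| := by
        have := Int.le_of_dvd (abs_pos.2 hb₀0) ((dvd_abs _ _).2 hAb₀)
        exact this
      have hzr : (b₀ : ℝ) * u + z * A = 0 := by exact_mod_cast hz
      have hval : b₀ * x + (b₁ * y + ∑ i, (b i : ℝ) * η i) + z = b₀ * d := by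
        have : ∑ i, (b i : ℝ) * η i = 0 := by simp [hb0]
        rw [this, hb₁0, hx]
        field_simp
        push_cast
        linear_combination hzr
      rw [hval, abs_mul, abs_of_pos hd]
      have : (A : ℝ) ≤ |(b₀ : ℝ)| := by exact_mod_cast hAle
      gcongr
    · refine main ?_
      have h1 : (1 : ℝ) ≤ |(N : ℝ)| := by exact_mod_cast Int.one_le_abs hN0
      have h2 : 1 / 4 / (B : ℝ) ^ m ≤ 1 := by
        have h3 : (1 : ℝ) ≤ (B : ℝ) ^ m := one_le_pow₀ (by exact_mod_cast hB)
        rw [div_le_one (by positivity)]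
        linarith
      rw [hS0, zero_add]
      exact h2.trans h1
  · exact main (hη b hb0 hbB N)

lemma mem_FSdualC_of_approximations {m : ℕ} {c : ℝ} {X : ℕ → ℕ} {p : ℕ → ℤ}
    {δ : ℕ → ℝ} (hX2 : ∀ k, 2 ≤ X k) (hXX : ∀ k, X k ^ 2 ≤ X (k + 1)) (hδ : ∀ k, 0 < δ k)
    (hXδ : ∀ k, |(X k : ℝ) * X (k + 1) ^ (m + 2) * δ k - c| ≤ 6 / X (k + 1))
    (hp : ∀ k, δ (k % 2) = p k / X k + δ k) {ξ : Fin (m + 2) → ℝ} (h0 : ξ 0 = δ 0)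
    (h1 : ξ 1 = δ 1)
    (hfreq : ∃ᶠ k in atTop, (X k : ℝ) * δ k ≤ psiDual (m + 2) ξ (X (k + 1) - 1)) :
    ξ ∈ FSdualC (m + 2) c := by
  have hXlt : StrictMono X := strictMono_nat_of_lt_succ fun k => by
    nlinarith [hX2 k, hXX k]
  have hXpos : ∀ k, (0 : ℝ) < X k := fun k => by
    have := hX2 k
    exact_mod_cast (by omega : 0 < X k)
  have hXtop : Tendsto (fun k => (X k : ℝ)) atTop atTop :=
    tendsto_natCast_atTop_atTop.comp hXlt.tendsto_atTop
  set f : ℝ → ℝ := fun t => t ^ (m + 2) * psiDual (m + 2) ξ t with hf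
  have hpsi : ∀ k (t : ℝ), (X k : ℝ) ≤ t → psiDual (m + 2) ξ t ≤ X k * δ k := by
    intro k t ht
    obtain ⟨i, hi⟩ : ∃ i : Fin (m + 2), ξ i = δ (k % 2) := by
      rcases Nat.mod_two_eq_zero_or_one k with h | h
      · exact ⟨0, by rw [h, h0]⟩
      · exact ⟨1, by rw [h, h1]⟩
    have hXne : (X k : ℤ) ≠ 0 := by have := hX2 k; omega
    have h := psiDual_le (ξ := ξ) (t := t) (Pi.single i (X k : ℤ)) (-p k)
      (fun h => hXne (by simpa using congrFun h i)) (fun j => by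
        rcases eq_or_ne j i with rfl | hj
        · simpa using ht
        · simpa [Pi.single_eq_of_ne hj] using (hXpos k).le.trans ht)
    have hsum : (∑ j, ((Pi.single i (X k : ℤ) : Fin (m + 2) → ℤ) j : ℝ) * ξ j) = X k * ξ i := by
      rw [Finset.sum_eq_single i (fun j _ hj => by simp [Pi.single_eq_of_ne hj])
        (fun h => absurd (Finset.mem_univ i) h)]
      simp
    have hval : (X k : ℝ) * ξ i + ((-p k : ℤ) : ℝ) = X k * δ k := by
      have := (hXpos k).ne'
      rw [hi, hp k]
      push_cast
      field_simp
      ring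
    rw [hsum, hval, abs_of_nonneg (mul_nonneg (hXpos k).le (hδ k).le)] at h
    exact h
  have hupper : ∀ t : ℝ, (X 0 : ℝ) ≤ t → f t ≤ c + 6 / t := by
    intro t ht
    have ht0 : 0 < t := (hXpos 0).trans_le ht
    have hex : ∃ j, t < X j := (hXtop.eventually_gt_atTop t).exists
    classical
    obtain ⟨k, hk⟩ : ∃ k, Nat.find hex = k + 1 := by
      refine Nat.exists_eq_succ_of_ne_zero fun h => ?_
      have := Nat.find_spec hex
      rw [h] at this
      linarith
    have hlt : t < X (k + 1) := hk ▸ Nat.find_spec hex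
    have hle : (X k : ℝ) ≤ t := not_lt.1 (Nat.find_min hex (by omega : k < Nat.find hex))
    calc f t ≤ (X (k + 1) : ℝ) ^ (m + 2) * (X k * δ k) := by
          have := hpsi k t hle
          have h2 := psiDual_nonneg (m + 2) ξ t
          simp only [hf]
          gcongr
      _ = (X k : ℝ) * X (k + 1) ^ (m + 2) * δ k := by ring
      _ ≤ c + 6 / X (k + 1) := by linarith [(abs_le.1 (hXδ k)).2]
      _ ≤ c + 6 / t := by gcongr
  have hnonneg : ∀ t : ℝ, 0 ≤ t → 0 ≤ f t := fun t ht =>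
    mul_nonneg (pow_nonneg ht _) (psiDual_nonneg _ _ _)
  have hev0 : ∀ᶠ t in atTop, 0 ≤ f t := (eventually_ge_atTop 0).mono hnonneg
  have hsmallt : ∀ ε : ℝ, 0 < ε → ∀ᶠ t : ℝ in atTop, 6 / t ≤ ε := fun ε hε => by
    have : Tendsto (fun t : ℝ => 6 / t) atTop (nhds 0) := tendsto_const_nhds.div_atTop tendsto_id
    exact (this.eventually_lt_const hε).mono fun _ h => h.le
  have hevle : ∀ ε : ℝ, 0 < ε → ∀ᶠ t in atTop, f t ≤ c + ε := fun ε hε => by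
    filter_upwards [hsmallt ε hε, eventually_ge_atTop (X 0 : ℝ)] with t h2 h3
    linarith [hupper t h3]
  constructor
  · refine le_antisymm (le_of_forall_pos_le_add fun ε hε => ?_)
      (le_of_forall_pos_le_add fun ε hε => ?_)
    · exact limsup_le_of_le (isCoboundedUnder_le_of_eventually_le _ hev0) (hevle ε hε)
    · have htend : Tendsto (fun k => (1 - 1 / (X (k + 1) : ℝ)) ^ (m + 2) * (c - 6 / X (k + 1)))
          atTop (nhds ((1 - 0) ^ (m + 2) * (c - 0))) := by
        have hX1 := hXtop.comp (tendsto_add_atTop_nat 1)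
        refine Tendsto.mul (Tendsto.pow (tendsto_const_nhds.sub ?_) _)
          (tendsto_const_nhds.sub ?_)
        · exact tendsto_const_nhds.div_atTop hX1
        · exact tendsto_const_nhds.div_atTop hX1
      rw [sub_zero, one_pow, one_mul, sub_zero] at htend
      have hev : ∀ᶠ k in atTop,
          c - ε < (1 - 1 / (X (k + 1) : ℝ)) ^ (m + 2) * (c - 6 / X (k + 1)) :=
        htend.eventually_const_lt (by linarith)
      have hfr : ∃ᶠ k in atTop, c - ε ≤ f (X (k + 1) - 1) := by
        refine (hfreq.and_eventually hev).mono ?_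
        rintro k ⟨hk1, hk2⟩
        refine hk2.le.trans ?_
        have hB := hXpos (k + 1)
        have hB2 : (2 : ℝ) ≤ X (k + 1) := by exact_mod_cast hX2 (k + 1)
        have h3 : (1 - 1 / (X (k + 1) : ℝ)) = (X (k + 1) - 1) / X (k + 1) := by field_simp
        have h4 : 0 ≤ (X (k + 1) - 1 : ℝ) := by linarith
        calc (1 - 1 / (X (k + 1) : ℝ)) ^ (m + 2) * (c - 6 / X (k + 1))
            ≤ (1 - 1 / (X (k + 1) : ℝ)) ^ (m + 2) * (X k * X (k + 1) ^ (m + 2) * δ k) := by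
              refine mul_le_mul_of_nonneg_left ?_ (pow_nonneg (by rw [h3]; positivity) _)
              linarith [(abs_le.1 (hXδ k)).1]
          _ = (X (k + 1) - 1 : ℝ) ^ (m + 2) * (X k * δ k) := by
              rw [h3, div_pow]
              field_simp
          _ ≤ f (X (k + 1) - 1) := by
              simp only [hf]
              gcongr
      have htop : Tendsto (fun k => (X (k + 1) : ℝ) - 1) atTop atTop :=
        tendsto_atTop_add_const_right _ _ (hXtop.comp (tendsto_add_atTop_nat 1))
      have := le_limsup_of_frequently_le (htop.frequently hfr)
        (isBoundedUnder_of_eventually_le (hevle 1 one_pos))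
      change c ≤ limsup f atTop + ε
      linarith
  · intro hlim
    change 0 < liminf f atTop at hlim
    set l := liminf f atTop with hl
    have hev := eventually_lt_of_lt_liminf (half_lt_self hlim)
      (isBoundedUnder_of_eventually_ge hev0)
    have hbound : ∀ k, f (X k) ≤ (c + 6) / X k := by
      intro k
      have hA := hXpos k
      have hB := hXpos (k + 1)
      have hsq : (X k : ℝ) ^ 2 ≤ X (k + 1) := by exact_mod_cast hXX k
      have hB1 : (1 : ℝ) ≤ X (k + 1) := by exact_mod_cast (by linarith [hX2 (k + 1)])
      have hA1 : (1 : ℝ) ≤ X k := by exact_mod_cast (by linarith [hX2 k])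
      have hG : (X k : ℝ) * X (k + 1) ^ (m + 2) * δ k ≤ c + 6 := by
        have : 6 / (X (k + 1) : ℝ) ≤ 6 := by
          rw [div_le_iff₀ hB]; linarith
        linarith [(abs_le.1 (hXδ k)).2]
      rw [le_div_iff₀ hA]
      calc f (X k) * X k ≤ (X k : ℝ) ^ (m + 2) * (X k * δ k) * X k := by
            have := hpsi k _ le_rfl
            simp only [hf]
            gcongr
        _ = (X k * δ k) * (X k) ^ (m + 3) := by ring
        _ ≤ (X k * δ k) * ((X k) ^ 2) ^ (m + 2) := by
            have := hδ k
            rw [← pow_mul]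
            gcongr
            omega
        _ ≤ (X k * δ k) * (X (k + 1)) ^ (m + 2) := by
            have := hδ k
            gcongr
        _ = X k * X (k + 1) ^ (m + 2) * δ k := by ring
        _ ≤ c + 6 := hG
    have htend : Tendsto (fun k => (c + 6) / (X k : ℝ)) atTop (nhds 0) :=
      tendsto_const_nhds.div_atTop hXtop
    obtain ⟨k, hk1, hk2⟩ :=
      ((hXtop.eventually hev).and (htend.eventually_lt_const (half_pos hlim))).exists
    linarith [hbound k]

lemma le_measure_setOf_frequently {α : Type*} [MeasurableSpace α] {μ : Measure α}
    {U : ℕ → Set α} {V : Set α} {ε : ℝ≥0∞} (hU : ∀ j, MeasurableSet (U j))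
    (hUV : ∀ j, U j ⊆ V) (hV : μ V ≠ ∞) (hε : ∀ j, ε ≤ μ (U j)) :
    ε ≤ μ {x | ∃ᶠ j in atTop, x ∈ U j} := by
  set W : ℕ → Set α := fun N => ⋃ j ≥ N, U j with hW
  have hset : {x | ∃ᶠ j in atTop, x ∈ U j} = ⋂ N, W N := by
    ext x
    simp [hW, frequently_atTop]
  have hWm : ∀ N, NullMeasurableSet (W N) μ := fun N =>
    (MeasurableSet.biUnion (Set.to_countable _) fun j _ => hU j).nullMeasurableSet
  have hWa : Antitone W := fun M N hMN =>
    Set.biUnion_subset_biUnion_left fun j hj => le_trans hMN hj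
  have hWV : W 0 ⊆ V := Set.iUnion₂_subset fun j _ => hUV j
  have htend := tendsto_measure_iInter_atTop hWm hWa
    ⟨0, ((measure_mono hWV).trans_lt hV.lt_top).ne⟩
  rw [hset]
  refine ge_of_tendsto' htend fun N => (hε N).trans (measure_mono ?_)
  exact Set.subset_iUnion₂_of_subset N le_rfl subset_rfl

lemma le_dimH_of_subset_image_tail {m : ℕ} {S : Set (Fin (m + 2) → ℝ)} {L : Set (Fin m → ℝ)}
    (hL : volume L ≠ 0) (hLS : L ⊆ (fun ξ i => ξ (Fin.succ (Fin.succ i))) '' S) :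
    (m : ℝ≥0∞) ≤ dimH S := by
  have hlip : LipschitzWith 1 (fun (ξ : Fin (m + 2) → ℝ) (i : Fin m) => ξ i.succ.succ) := by
    refine LipschitzWith.of_dist_le_mul fun ξ ζ => ?_
    rw [NNReal.coe_one, one_mul]
    exact (dist_pi_le_iff dist_nonneg).2 fun i => dist_le_pi_dist ξ ζ i.succ.succ
  have h1 : ((m : NNReal) : ℝ≥0∞) ≤ dimH L := by
    refine le_dimH_of_hausdorffMeasure_ne_zero ?_
    have := hausdorffMeasure_pi_real (ι := Fin m)
    rw [Fintype.card_fin] at this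
    rw [NNReal.coe_natCast, this]
    exact hL
  simpa using h1.trans ((dimH_mono hLS).trans (hlip.dimH_image_le S))

lemma scaled_errors_le {m : ℕ} {A B C c d d' : ℝ} (hA : 1 ≤ A) (hc : c ≤ 1)
    (hAB : A ^ 2 ≤ B) (hBC : B ^ 2 ≤ C) (hd : 0 < d) (hd' : 0 < d')
    (h : A * B ^ (m + 2) * d ≤ c + 6 / B) (h' : B * C ^ (m + 2) * d' ≤ c + 6 / C)
    (hcA : c + 20 / A ≤ 1 / 4) :
    A * B * (A * d + B * d + B * d') ≤ 1 / 4 / B ^ m := by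
  have hA0 : 0 < A := by linarith
  have hB : A ≤ B := by nlinarith
  have hB1 : 1 ≤ B := hA.trans hB
  have hB0 : 0 < B := by linarith
  have hC : B ≤ C := by nlinarith
  have hC0 : 0 < C := by linarith
  have h6 : 6 / B ≤ 6 := by rw [div_le_iff₀ hB0]; linarith
  have h6' : 6 / C ≤ 6 := by rw [div_le_iff₀ hC0]; linarith
  have hBA : 6 / B ≤ 6 / A := by gcongr
  rw [le_div_iff₀ (by positivity)]
  have e1 : A * A * B ^ (m + 1) * d ≤ 7 / A := by
    rw [le_div_iff₀ hA0]
    calc A * A * B ^ (m + 1) * d * A = A * B ^ (m + 1) * d * A ^ 2 := by ring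
      _ ≤ A * B ^ (m + 1) * d * B := by gcongr
      _ = A * B ^ (m + 2) * d := by ring
      _ ≤ 7 := by linarith
  have e2 : A * B ^ (m + 2) * d' ≤ 7 / A := by
    rw [le_div_iff₀ hA0]
    calc A * B ^ (m + 2) * d' * A = A ^ 2 * (B ^ (m + 2) * d') := by ring
      _ ≤ B * (B ^ (m + 2) * d') := by gcongr
      _ ≤ B * (C ^ (m + 2) * d') := by gcongr
      _ ≤ 7 := by linarith
  have e3 : 20 / A = 7 / A + 6 / A + 7 / A := by ring
  calc A * B * (A * d + B * d + B * d') * B ^ m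
      = A * A * B ^ (m + 1) * d + A * B ^ (m + 2) * d + A * B ^ (m + 2) * d' := by ring
    _ ≤ 1 / 4 := by linarith

lemma natCast_le_dimH_FSdualC_of_pos {m : ℕ} (hm : 1 ≤ m) {c : ℝ} (hc : 0 < c)
    (hc4 : c < 1 / 4) : (m : ℝ≥0∞) ≤ dimH (FSdualC (m + 2) c) := by
  obtain ⟨X, p, δ, hX2, hXX, hcop, hδ, hXδ, hp, hpcop⟩ :=
    exists_alternating_approximations (n := m + 2) (by omega) hc (by linarith)
  obtain ⟨ε, hε, T, hT⟩ := exists_isOpen_no_small_values hm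
  have hXpos : ∀ k, 0 < X k := fun k => by have := hX2 k; omega
  have hXlt : StrictMono X := strictMono_nat_of_lt_succ fun k => by
    nlinarith [hX2 k, hXX k]
  obtain ⟨J, hJ⟩ := exists_nat_ge (max (T : ℝ) (20 / (1 / 4 - c)))
  have hJX : ∀ k, J ≤ k → J ≤ X k := fun k hk => hk.trans hXlt.le_apply
  have hex : ∀ j : ℕ, ∃ U : Set (Fin m → ℝ), IsOpen U ∧ U ⊆ Metric.ball 0 3 ∧
      ENNReal.ofReal ε ≤ volume U ∧ ∀ η ∈ U, ∀ b : Fin m → ℤ, b ≠ 0 →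
        (∀ i, |b i| < (X (2 * (j + J + 1) + 1) : ℕ)) → ∀ z : ℤ,
          1 / 4 / ((X (2 * (j + J + 1) + 1) : ℕ) : ℝ) ^ m ≤
            |∑ i, (b i : ℝ) *
              (((X (2 * (j + J + 1)) * X (2 * (j + J + 1) + 1) : ℕ) : ℝ) * η i) + z| := by
    intro j
    refine hT _ ?_ _ (Nat.mul_pos (hXpos _) (hXpos _))
    have h1 : (T : ℝ) ≤ J := (le_max_left _ _).trans hJ
    exact (by exact_mod_cast h1 : T ≤ J).trans (hJX _ (by omega))
  choose U hUo hUb hUv hU using hex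
  refine le_dimH_of_subset_image_tail (L := {η | ∃ᶠ j in atTop, η ∈ U j}) ?_ ?_
  · have := le_measure_setOf_frequently (fun j => (hUo j).measurableSet) hUb
      Metric.isBounded_ball.measure_lt_top.ne hUv
    exact ((ENNReal.ofReal_pos.2 hε).trans_le this).ne'
  · intro η hη
    refine ⟨Fin.cons (δ 0) (Fin.cons (δ 1) η), ?_, by ext i; simp⟩
    refine mem_FSdualC_of_approximations hX2 hXX hδ hXδ hp rfl rfl ?_
    have htop : Tendsto (fun j => 2 * (j + J + 1)) atTop atTop :=
      tendsto_atTop_mono (fun j => by omega : ∀ j, j ≤ 2 * (j + J + 1)) tendsto_id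
    refine htop.frequently (hη.mono fun j hj => ?_)
    have hUj := hU j η hj
    have hk0 : (2 * (j + J + 1)) % 2 = 0 := by omega
    have hk1 : (2 * (j + J + 1) + 1) % 2 = 1 := by omega
    have hkJ : J ≤ X (2 * (j + J + 1)) := hJX _ (by omega)
    have hu : IsCoprime (p (2 * (j + J + 1))) (X (2 * (j + J + 1)) : ℤ) := hpcop (2 * (j + J))
    have hv : IsCoprime (p (2 * (j + J + 1) + 1)) (X (2 * (j + J + 1) + 1) : ℤ) :=
      hpcop (2 * (j + J) + 1)
    generalize 2 * (j + J + 1) = k at *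
    have hx := hp k
    have hy := hp (k + 1)
    rw [hk0] at hx
    rw [hk1] at hy
    have hAr : (0 : ℝ) < X k := by exact_mod_cast hXpos k
    have hA1 : (1 : ℝ) ≤ X k := by exact_mod_cast hXpos k
    have hB2 : (2 : ℝ) ≤ X (k + 1) := by exact_mod_cast hX2 (k + 1)
    have hsmall : (X k * X (k + 1) : ℝ) * (X k * δ k + X (k + 1) * δ k + X (k + 1) * δ (k + 1)) ≤
        1 / 4 / (X (k + 1) : ℝ) ^ m := by
      refine scaled_errors_le (c := c) (C := X (k + 2)) hA1 (by linarith)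
        (by exact_mod_cast hXX k) (by exact_mod_cast hXX (k + 1)) (hδ k) (hδ (k + 1))
        (by linarith [(abs_le.1 (hXδ k)).2]) (by linarith [(abs_le.1 (hXδ (k + 1))).2]) ?_
      have h1 : 20 / (1 / 4 - c) ≤ X k :=
        ((le_max_right _ _).trans hJ).trans (by exact_mod_cast hkJ)
      rw [div_le_iff₀ (by linarith)] at h1
      have h2 : 20 / (X k : ℝ) ≤ 1 / 4 - c := by
        rw [div_le_iff₀ hAr]; linarith
      linarith
    refine le_psiDual (by omega) (by linarith) fun b hb hbt z => ?_
    have hlt : ∀ i, |b i| < (X (k + 1) : ℤ) := fun i => by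
      have : |(b i : ℝ)| < X (k + 1) := by linarith [hbt i]
      exact_mod_cast this
    rw [Fin.sum_univ_succ, Fin.sum_univ_succ]
    refine mul_le_abs_linear_form (b := fun i => b i.succ.succ) (hXpos k) (hXpos (k + 1))
      (hcop k) hu hv hx hy (hδ k) (hδ (k + 1)) hUj hsmall ?_ (hlt _) (hlt _)
      (fun i => hlt _) z
    rintro ⟨h0, h1, h2⟩
    refine hb (funext fun i => ?_)
    refine Fin.cases h0 (fun i => Fin.cases h1 (fun i => congrFun h2 i) i) i

lemma natCast_le_dimH_FSdualC_zero (m : ℕ) : (m : ℝ≥0∞) ≤ dimH (FSdualC (m + 2) 0) := by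
  refine le_dimH_of_subset_image_tail (L := Set.univ) (by simp [NeZero.ne]) fun η _ => ?_
  refine ⟨Fin.cons 0 (Fin.cons 0 η), ?_, by ext i; simp⟩
  set ξ : Fin (m + 2) → ℝ := Fin.cons 0 (Fin.cons 0 η) with hξ
  have hev : (fun t : ℝ => t ^ (m + 2) * psiDual (m + 2) ξ t) =ᶠ[atTop] fun _ => 0 := by
    filter_upwards [eventually_ge_atTop 1] with t ht
    have h := psiDual_le (ξ := ξ) (t := t) (Pi.single 0 1) 0
      (by simp) (fun j => by
        rcases eq_or_ne j 0 with rfl | hj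
        · simpa using ht
        · simpa [Pi.single_eq_of_ne hj] using zero_le_one.trans ht)
    have hsum : (∑ j, ((Pi.single 0 1 : Fin (m + 2) → ℤ) j : ℝ) * ξ j) = 0 := by
      rw [Fin.sum_univ_succ]
      simp [hξ]
    rw [hsum, Int.cast_zero, add_zero, abs_zero] at h
    rw [le_antisymm h (psiDual_nonneg _ _ _), mul_zero]
  refine ⟨?_, ?_⟩
  · change limsup _ _ = _
    rw [limsup_congr hev, limsup_const]
  · intro h
    change 0 < liminf (fun t : ℝ => t ^ (m + 2) * psiDual (m + 2) ξ t) atTop at h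
    rw [liminf_congr hev, liminf_const] at h
    exact lt_irrefl 0 h

lemma gammaConst_pos_and_lt {n : ℕ} (hn : 4 ≤ n) :
    0 < ((n : ℝ) - 3) / (8 * ((n : ℝ) - 2) ^ ((3 : ℝ) / 2)) * Real.sqrt Real.pi *
        (Real.Gamma ((n : ℝ) - 1 / 2) / Real.Gamma (n : ℝ)) ∧
      ((n : ℝ) - 3) / (8 * ((n : ℝ) - 2) ^ ((3 : ℝ) / 2)) * Real.sqrt Real.pi *
        (Real.Gamma ((n : ℝ) - 1 / 2) / Real.Gamma (n : ℝ)) < 1 / 4 := by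
  have hn4 : (4 : ℝ) ≤ n := by exact_mod_cast hn
  have h3 : 0 < (n : ℝ) - 3 := by linarith
  have h2 : 1 ≤ (n : ℝ) - 2 := by linarith
  have hpow : (n : ℝ) - 2 ≤ ((n : ℝ) - 2) ^ ((3 : ℝ) / 2) :=
    Real.self_le_rpow_of_one_le h2 (by norm_num)
  have hpow0 : 0 < ((n : ℝ) - 2) ^ ((3 : ℝ) / 2) := by linarith
  have hG1 : 0 < Real.Gamma ((n : ℝ) - 1 / 2) := Real.Gamma_pos_of_pos (by linarith)
  have hG2 : 0 < Real.Gamma (n : ℝ) := Real.Gamma_pos_of_pos (by linarith)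
  have hpi : 0 < Real.sqrt Real.pi := Real.sqrt_pos.2 Real.pi_pos
  have hpi2 : Real.sqrt Real.pi < 2 := by
    rw [Real.sqrt_lt' two_pos]
    linarith [Real.pi_lt_four]
  have hGle : Real.Gamma ((n : ℝ) - 1 / 2) ≤ Real.Gamma (n : ℝ) :=
    (Real.Gamma_strictMonoOn_Ici (Set.mem_Ici.2 (by linarith)) (Set.mem_Ici.2 (by linarith))
      (by linarith)).le
  have hG : Real.Gamma ((n : ℝ) - 1 / 2) / Real.Gamma (n : ℝ) ≤ 1 := (div_le_one hG2).2 hGle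
  have hq : ((n : ℝ) - 3) / (8 * ((n : ℝ) - 2) ^ ((3 : ℝ) / 2)) ≤ 1 / 8 := by
    rw [div_le_iff₀ (by positivity)]
    linarith
  refine ⟨by positivity, ?_⟩
  calc _ ≤ 1 / 8 * Real.sqrt Real.pi * 1 := by gcongr
    _ < 1 / 4 := by linarith

/-- for `n ≥ 4` there is an explicitly computable `c_n ∈ (0,1)`, namely
`c_n = ((n−3)/(8(n−2)^{3/2}))·√π·Γ(n−1/2)/Γ(n)`, such that for any `c ∈ [0, c_n)`,
`dim_H FS_n(c) ≥ n − 2`. -/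
theorem dimH_FSdualC_ge (n : ℕ) (hn : 4 ≤ n) :
    ∃ cn : ℝ,
      cn = ((n : ℝ) - 3) / (8 * ((n : ℝ) - 2) ^ ((3 : ℝ) / 2)) * Real.sqrt Real.pi *
        (Real.Gamma ((n : ℝ) - 1 / 2) / Real.Gamma (n : ℝ)) ∧
      0 < cn ∧ cn < 1 ∧
      ∀ c : ℝ, 0 ≤ c → c < cn →
        ((n - 2 : ℕ) : ℝ≥0∞) ≤ dimH (FSdualC n c) := by
  obtain ⟨hpos, hlt⟩ := gammaConst_pos_and_lt hn
  refine ⟨_, rfl, hpos, hlt.trans (by norm_num), fun c hc0 hc => ?_⟩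
  obtain ⟨m, rfl⟩ : ∃ m, n = m + 2 := ⟨n - 2, by omega⟩
  rw [Nat.add_sub_cancel]
  rcases hc0.eq_or_lt with rfl | hc0
  · exact natCast_le_dimH_FSdualC_zero m
  · exact natCast_le_dimH_FSdualC_of_pos (by omega) hc0 (hc.trans hlt)
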